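/- Let h : ℝ^d → ℝ be α-Hölder for some α ∈ (0,1], and let f_h(x) = −∫₀¹ (1/(2t)) E[ h̄(√t x + √(1−t) Z) ] dt with h̄ = h − E h(Z), Z ~ N(0, I_d). Then for all x ≠ y in ℝ^d, ‖∇²f_h(x) − ∇²f_h(y)‖_op ≤ |x−y|^α (C₁(α,d) + |log|x−y||) [h]_α, where C₁(α,d) = 2^{α/2+1} ((α+2d)/(αd)) Γ((α+d)/2)/Γ(d/2). -/

import Mathlib

open MeasureTheory ProbabilityTheory Real Filter Set

noncomputable section

/-- The standard Gaussian measure `N(0, I_d)` on `ℝ^d` (as `EuclideanSpace ℝ (Fin d)`). -/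
def stdGaussian (d : ℕ) : Measure (EuclideanSpace ℝ (Fin d)) :=
  (Measure.pi fun _ : Fin d => gaussianReal 0 1).map
    ⇑(EuclideanSpace.equiv (Fin d) ℝ).symm

/-- Partial derivative in the `j`-th coordinate direction. -/
def pderivI {d : ℕ} (j : Fin d) (f : EuclideanSpace ℝ (Fin d) → ℝ) :
    EuclideanSpace ℝ (Fin d) → ℝ :=
  fun x => fderiv ℝ f x (EuclideanSpace.single j 1)

/-- Iterated partial derivative along a list of coordinate directions (head applied last,
i.e. outermost). -/
def pderivList {d : ℕ} : List (Fin d) → (EuclideanSpace ℝ (Fin d) → ℝ) →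
    EuclideanSpace ℝ (Fin d) → ℝ
  | [], f => f
  | j :: l, f => pderivI j (pderivList l f)

/-- Multi-index partial derivative `∂^{|m|}/(∂x₁^{m₁} ⋯ ∂x_d^{m_d})`. -/
def pderivMulti {d : ℕ} (m : Fin d → ℕ) (f : EuclideanSpace ℝ (Fin d) → ℝ) :
    EuclideanSpace ℝ (Fin d) → ℝ :=
  pderivList ((List.finRange d).flatMap fun j => List.replicate (m j) j) f

/-- Multivariate Hermite polynomial
`H_m(x) = (-1)^{|m|} e^{|x|²/2} ∂^{|m|}/(∂x₁^{m₁} ⋯ ∂x_d^{m_d}) e^{-|x|²/2}`. -/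
def hermiteMulti {d : ℕ} (m : Fin d → ℕ) (x : EuclideanSpace ℝ (Fin d)) : ℝ :=
  (-1 : ℝ) ^ (∑ j, m j) * Real.exp (‖x‖ ^ 2 / 2) *
    pderivMulti m (fun y => Real.exp (-‖y‖ ^ 2 / 2)) x

/-- `h̄ = h - E h(Z)` with `Z ~ N(0, I_d)`. -/
def hbar (d : ℕ) (h : EuclideanSpace ℝ (Fin d) → ℝ) (x : EuclideanSpace ℝ (Fin d)) : ℝ :=
  h x - ∫ z, h z ∂(stdGaussian d)

/-- Barbour's solution `f_h(x) = -∫₀¹ (1/(2t)) E[ h̄(√t x + √(1-t) Z) ] dt` of the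
multivariate Stein equation. -/
def steinSol (d : ℕ) (h : EuclideanSpace ℝ (Fin d) → ℝ) (x : EuclideanSpace ℝ (Fin d)) : ℝ :=
  -∫ t in Ioo (0 : ℝ) 1,
      (1 / (2 * t)) *
        ∫ z, hbar d h (Real.sqrt t • x + Real.sqrt (1 - t) • z) ∂(stdGaussian d)

/-- Entry `(i, j)` of the Hessian matrix of `f` at `x`. -/
def hessEntry {d : ℕ} (f : EuclideanSpace ℝ (Fin d) → ℝ) (x : EuclideanSpace ℝ (Fin d))
    (i j : Fin d) : ℝ :=
  pderivI i (pderivI j f) x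

/-- The Hessian matrix `∇² f(x)`. -/
def hessMatrix {d : ℕ} (f : EuclideanSpace ℝ (Fin d) → ℝ) (x : EuclideanSpace ℝ (Fin d)) :
    Matrix (Fin d) (Fin d) ℝ :=
  Matrix.of fun i j => hessEntry f x i j

/-- Operator norm `‖M‖_op = sup_{|v| = 1} |M v|` (Euclidean norms) of a `d × d` matrix. -/
def matOpNorm {d : ℕ} (M : Matrix (Fin d) (Fin d) ℝ) : ℝ :=
  sSup { r | ∃ v : EuclideanSpace ℝ (Fin d), ‖v‖ = 1 ∧
    r = ‖(WithLp.equiv 2 (Fin d → ℝ)).symm (M.mulVec ((WithLp.equiv 2 (Fin d → ℝ)) v))‖ }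

/-- The Laplacian `Δ f(x) = ∑ i ∂²f/∂x_i²(x)`. -/
def laplacian {d : ℕ} (f : EuclideanSpace ℝ (Fin d) → ℝ) (x : EuclideanSpace ℝ (Fin d)) : ℝ :=
  ∑ i, hessEntry f x i i

/-- `C` is an `α`-Hölder constant for `h`. -/
def HolderConst {d : ℕ} (α C : ℝ) (h : EuclideanSpace ℝ (Fin d) → ℝ) : Prop :=
  ∀ x y, |h x - h y| ≤ C * dist x y ^ α

/-- The 1-Wasserstein distance in dual form: sup over 1-Lipschitz test functions. -/
def wasserstein1 {d : ℕ} (μ ν : Measure (EuclideanSpace ℝ (Fin d))) : ℝ :=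
  sSup { r | ∃ h : EuclideanSpace ℝ (Fin d) → ℝ, LipschitzWith 1 h ∧
    r = (∫ x, h x ∂μ) - ∫ x, h x ∂ν }

/-- The `α`-Wasserstein distance: sup over continuous `h` with `[h]_α ≤ 1`. -/
def wassersteinHolder {d : ℕ} (α : ℝ) (μ ν : Measure (EuclideanSpace ℝ (Fin d))) : ℝ :=
  sSup { r | ∃ h : EuclideanSpace ℝ (Fin d) → ℝ, Continuous h ∧ HolderConst α 1 h ∧
    r = (∫ x, h x ∂μ) - ∫ x, h x ∂ν }

/-- The constant `C₁(α, d)`. -/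
def C1 (α : ℝ) (d : ℕ) : ℝ :=
  2 ^ (α / 2 + 1) * ((α + 2 * d) / (α * d)) * Real.Gamma ((α + d) / 2) / Real.Gamma (d / 2)

/-- The constant `C₂(α, d)`. -/
def C2 (α : ℝ) (d : ℕ) : ℝ :=
  if α = 1 then 2 * Real.sqrt (2 / π) * Real.sqrt d
  else 2 ^ (α / 2 + 1) * (α + 2 * d) * Real.Gamma ((α + d) / 2) / (α * Real.Gamma (d / 2))

end

open scoped Topology

/-- The normalising constant of the standard Gaussian density on `E`. -/
noncomputable def gaussianNorm (E : Type*) [NormedAddCommGroup E] [InnerProductSpace ℝ E] : ℝ :=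
  ((2 * π) ^ (Module.finrank ℝ E / 2 : ℝ))⁻¹

lemma gaussianNorm_pos (E : Type*) [NormedAddCommGroup E] [InnerProductSpace ℝ E] :
    0 < gaussianNorm E := by
  unfold gaussianNorm; positivity

section Gaussian

variable {E : Type*} [NormedAddCommGroup E] [InnerProductSpace ℝ E] [FiniteDimensional ℝ E]
  [MeasurableSpace E] [BorelSpace E]

lemma integrable_exp_neg_mul_norm_sq {b : ℝ} (hb : 0 < b) :
    Integrable (fun w : E => Real.exp (-b * ‖w‖ ^ 2)) := by
  have := (GaussianFourier.integrable_cexp_neg_mul_sq_norm_add (V := E) (b := (b : ℂ))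
    (by simpa using hb) 0 0).re
  refine this.congr (Eventually.of_forall fun w => ?_)
  have : (-(b : ℂ) * (‖w‖ : ℂ) ^ 2 + 0 * ((inner ℝ (0 : E) w : ℝ) : ℂ))
      = ((-b * ‖w‖ ^ 2 : ℝ) : ℂ) := by
    push_cast; ring
  simp only [RCLike.re_eq_complex_re]
  rw [this, Complex.exp_ofReal_re]

variable (E) in
lemma stdGaussian_eq_withDensity :
    ProbabilityTheory.stdGaussian E = volume.withDensity
      (fun w : E => ENNReal.ofReal (gaussianNorm E * Real.exp (-(1 / 2) * ‖w‖ ^ 2))) := by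
  have hint : Integrable (fun w : E => gaussianNorm E * Real.exp (-(1 / 2) * ‖w‖ ^ 2)) :=
    (integrable_exp_neg_mul_norm_sq (by norm_num)).const_mul _
  have hc := gaussianNorm_pos E
  have : IsFiniteMeasure (volume.withDensity
      (fun w : E => ENNReal.ofReal (gaussianNorm E * Real.exp (-(1 / 2) * ‖w‖ ^ 2)))) :=
    isFiniteMeasure_withDensity_ofReal hint.2
  refine Measure.ext_of_charFun ?_
  ext t
  rw [charFun_stdGaussian, charFun_apply, integral_withDensity_eq_integral_toReal_smul
    (by fun_prop) (by simp)]
  have h1 : ∀ w : E, (ENNReal.ofReal (gaussianNorm E * Real.exp (-(1 / 2) * ‖w‖ ^ 2))).toReal •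
      Complex.exp ((inner ℝ w t : ℝ) * Complex.I) =
      (gaussianNorm E : ℂ) * Complex.exp (-(1 / 2 : ℂ) * ‖w‖ ^ 2 + Complex.I * (inner ℝ t w : ℝ)) := by
    intro w
    rw [ENNReal.toReal_ofReal (by positivity), Complex.real_smul, real_inner_comm, Complex.exp_add]
    push_cast
    rw [mul_assoc]
    congr 3
    ring
  simp_rw [h1]
  rw [integral_const_mul, GaussianFourier.integral_cexp_neg_mul_sq_norm_add (by norm_num)]
  have h2 : ((π : ℂ) / (1 / 2)) ^ (Module.finrank ℝ E / 2 : ℂ)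
      = (((gaussianNorm E)⁻¹ : ℝ) : ℂ) := by
    rw [gaussianNorm, inv_inv, Complex.ofReal_cpow (by positivity)]
    push_cast
    congr 1
    ring
  rw [h2, ← mul_assoc, ← Complex.ofReal_mul, mul_inv_cancel₀ hc.ne', Complex.ofReal_one, one_mul,
    Complex.I_sq]
  congr 1
  ring

lemma integral_stdGaussian {F : Type*} [NormedAddCommGroup F] [NormedSpace ℝ F] (f : E → F) :
    ∫ z, f z ∂(ProbabilityTheory.stdGaussian E) =
      gaussianNorm E • ∫ w, Real.exp (-(1 / 2) * ‖w‖ ^ 2) • f w := by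
  have hc := gaussianNorm_pos E
  rw [stdGaussian_eq_withDensity, integral_withDensity_eq_integral_toReal_smul
    (by fun_prop) (by simp), ← integral_smul]
  refine integral_congr_ae (Eventually.of_forall fun w => ?_)
  simp only
  rw [ENNReal.toReal_ofReal (by positivity), mul_smul]

lemma integrable_stdGaussian_iff {F : Type*} [NormedAddCommGroup F] [NormedSpace ℝ F]
    {f : E → F} : Integrable f (ProbabilityTheory.stdGaussian E) ↔
      Integrable (fun w => Real.exp (-(1 / 2) * ‖w‖ ^ 2) • f w) := by
  have hc := gaussianNorm_pos E
  rw [stdGaussian_eq_withDensity, integrable_withDensity_iff_integrable_smul'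
    (by fun_prop) (by simp),
    ← integrable_smul_iff hc.ne' (fun w => Real.exp (-(1 / 2) * ‖w‖ ^ 2) • f w)]
  refine integrable_congr (Eventually.of_forall fun w => ?_)
  simp only [Pi.smul_apply]
  rw [ENNReal.toReal_ofReal (by positivity), mul_smul]

lemma exp_mul_exp_neg_sq_le (a b r : ℝ) (hb : 0 < b) :
    Real.exp (a * r) * Real.exp (-b * r ^ 2) ≤
      Real.exp (a ^ 2 / (2 * b)) * Real.exp (-(b / 2) * r ^ 2) := by
  rw [← Real.exp_add, ← Real.exp_add]
  refine Real.exp_le_exp.2 ?_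
  have : a ^ 2 / (2 * b) + -(b / 2) * r ^ 2 - (a * r + -b * r ^ 2) = (a - b * r) ^ 2 / (2 * b) := by
    field_simp; ring
  have h2 : 0 ≤ (a - b * r) ^ 2 / (2 * b) := by positivity
  linarith

lemma integrable_exp_mul_exp_neg_sq (a : ℝ) {b : ℝ} (hb : 0 < b) :
    Integrable (fun w : E => Real.exp (a * ‖w‖) * Real.exp (-b * ‖w‖ ^ 2)) := by
  refine ((integrable_exp_neg_mul_norm_sq (E := E) (half_pos hb)).const_mul
    (Real.exp (a ^ 2 / (2 * b)))).mono' (by fun_prop) (Eventually.of_forall fun w => ?_)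
  rw [Real.norm_of_nonneg (by positivity)]
  exact exp_mul_exp_neg_sq_le a b _ hb

lemma integrable_stdGaussian_of_norm_le {F : Type*} [NormedAddCommGroup F] [NormedSpace ℝ F]
    {f : E → F} (hf : AEStronglyMeasurable f (volume : Measure E)) {A a : ℝ}
    (hA : ∀ z, ‖f z‖ ≤ A * Real.exp (a * ‖z‖)) :
    Integrable f (ProbabilityTheory.stdGaussian E) := by
  rw [integrable_stdGaussian_iff]
  refine ((integrable_exp_mul_exp_neg_sq (E := E) a (b := 1 / 2) (by norm_num)).const_mul A).mono'
    (AEStronglyMeasurable.smul (by fun_prop) hf) (Eventually.of_forall fun w => ?_)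
  rw [norm_smul, Real.norm_of_nonneg (by positivity)]
  have := mul_le_mul_of_nonneg_left (hA w) (Real.exp_pos (-(1 / 2) * ‖w‖ ^ 2)).le
  linarith

end Gaussian

section Shift

variable {E : Type*} [NormedAddCommGroup E] [InnerProductSpace ℝ E]

/-- The differential form `z ↦ p(z) ⟨z, ·⟩ - Dp(z)` obtained by integrating `p` by parts against
the Gaussian density. -/
noncomputable def gaussianDual (p : E → ℝ) (p' : E → E →L[ℝ] ℝ) (z : E) : E →L[ℝ] ℝ :=
  p z • innerSL ℝ z - p' z

/-- A `C¹` weight which, together with its derivative, grows at most exponentially. -/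
structure IsGaussianWeight (p : E → ℝ) (p' : E → E →L[ℝ] ℝ) (A a : ℝ) : Prop where
  hasFDerivAt : ∀ w, HasFDerivAt p (p' w) w
  continuous_deriv : Continuous p'
  norm_le : ∀ w, ‖p w‖ ≤ A * Real.exp (a * ‖w‖)
  norm_deriv_le : ∀ w, ‖p' w‖ ≤ A * Real.exp (a * ‖w‖)

lemma IsGaussianWeight.continuous {p : E → ℝ} {p' : E → E →L[ℝ] ℝ} {A a : ℝ}
    (hp : IsGaussianWeight p p' A a) : Continuous p :=
  continuous_iff_continuousAt.2 fun w => (hp.hasFDerivAt w).continuousAt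

lemma IsGaussianWeight.continuous_dual {p : E → ℝ} {p' : E → E →L[ℝ] ℝ} {A a : ℝ}
    (hp : IsGaussianWeight p p' A a) : Continuous (gaussianDual p p') :=
  (hp.continuous.smul (innerSL ℝ).continuous).sub hp.continuous_deriv

lemma IsGaussianWeight.norm_dual_le {p : E → ℝ} {p' : E → E →L[ℝ] ℝ} {A a : ℝ}
    (hp : IsGaussianWeight p p' A a) (w : E) : ‖gaussianDual p p' w‖ ≤ 2 * A * Real.exp ((a + 1) * ‖w‖) := by
  have h0 : 0 ≤ A * Real.exp (a * ‖w‖) := (norm_nonneg _).trans (hp.norm_le w)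
  have h1 : ‖w‖ ≤ Real.exp ‖w‖ := by linarith [Real.add_one_le_exp ‖w‖]
  have h2 : 1 ≤ Real.exp ‖w‖ := Real.one_le_exp (norm_nonneg w)
  calc ‖gaussianDual p p' w‖ ≤ ‖p w • innerSL ℝ w‖ + ‖p' w‖ := norm_sub_le _ _
    _ = ‖p w‖ * ‖w‖ + ‖p' w‖ := by rw [norm_smul, innerSL_apply_norm]
    _ ≤ A * Real.exp (a * ‖w‖) * Real.exp ‖w‖ + A * Real.exp (a * ‖w‖) * Real.exp ‖w‖ := by
        refine add_le_add ?_ ?_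
        · exact mul_le_mul (hp.norm_le w) h1 (norm_nonneg _) h0
        · exact (hp.norm_deriv_le w).trans (le_mul_of_one_le_right h0 h2)
    _ = 2 * A * Real.exp ((a + 1) * ‖w‖) := by
        rw [add_mul, one_mul, Real.exp_add]; ring

lemma hasFDerivAt_exp_neg_norm_sq_mul {p : E → ℝ} {p' : E → E →L[ℝ] ℝ} {w : E}
    (hp : HasFDerivAt p (p' w) w) :
    HasFDerivAt (fun w : E => Real.exp (-(1 / 2) * ‖w‖ ^ 2) * p w)
      (-(Real.exp (-(1 / 2) * ‖w‖ ^ 2) • gaussianDual p p' w)) w := by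
  have h1 : HasFDerivAt (fun w : E => ‖w‖ ^ 2) (2 • innerSL ℝ w) w :=
    (hasStrictFDerivAt_norm_sq w).hasFDerivAt
  have h2 := ((h1.const_mul (-(1 / 2))).exp).mul hp
  refine h2.congr_fderiv ?_
  ext v
  simp only [gaussianDual, add_apply, smul_apply, neg_apply, sub_apply, smul_eq_mul, nsmul_eq_mul]
  push_cast
  ring

variable [FiniteDimensional ℝ E] [MeasurableSpace E] [BorelSpace E]

/-- Gaussian integration by parts for shifts: differentiability of `y ↦ E[p(Z) g(Z + y)]` for
continuous `g` of exponential growth. -/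
theorem hasFDerivAt_integral_stdGaussian_shift {p : E → ℝ} {p' : E → E →L[ℝ] ℝ} {A a : ℝ}
    (hp : IsGaussianWeight p p' A a) {g : E → ℝ} (hg : Continuous g) {B b : ℝ} (hb : 0 ≤ b)
    (hgb : ∀ w, ‖g w‖ ≤ B * Real.exp (b * ‖w‖)) (y₀ : E) :
    HasFDerivAt (fun y => ∫ z, p z * g (z + y) ∂(ProbabilityTheory.stdGaussian E))
      (∫ z, g (z + y₀) • gaussianDual p p' z ∂(ProbabilityTheory.stdGaussian E)) y₀ := by
  have hpc := hp.continuous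
  have hqc := hp.continuous_dual
  have hqb := hp.norm_dual_le
  set q := gaussianDual p p' with hq
  have hA : 0 ≤ A := by simpa using (norm_nonneg _).trans (hp.norm_le 0)
  have hB : 0 ≤ B := by simpa using (norm_nonneg _).trans (hgb 0)
  let k : E → ℝ := fun w => Real.exp (-(1 / 2) * ‖w‖ ^ 2) * p w
  let k' : E → E →L[ℝ] ℝ := fun w => Real.exp (-(1 / 2) * ‖w‖ ^ 2) • q w
  have hkc : Continuous k := by fun_prop
  have hkc' : Continuous k' := by fun_prop
  have hrew : ∀ y, ∫ z, p z * g (z + y) ∂(ProbabilityTheory.stdGaussian E)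
      = gaussianNorm E • ∫ w, k (w - y) * g w := by
    intro y
    rw [integral_stdGaussian, ← integral_sub_right_eq_self _ y]
    simp only [sub_add_cancel, smul_eq_mul, k, mul_assoc]
  have hrew' : ∫ z, g (z + y₀) • q z ∂(ProbabilityTheory.stdGaussian E)
      = gaussianNorm E • ∫ w, g w • k' (w - y₀) := by
    rw [integral_stdGaussian, ← integral_sub_right_eq_self _ y₀]
    simp only [sub_add_cancel, k']
    congr 2
    ext1 w
    rw [smul_comm]
  simp_rw [hrew]
  rw [hrew']
  suffices hmain : HasFDerivAt (fun y => ∫ w, k (w - y) * g w) (∫ w, g w • k' (w - y₀)) y₀ from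
    hmain.fun_const_smul _
  have hexpg : ∀ w, ‖g w‖ ≤ B * Real.exp (b * ‖y₀‖) * Real.exp (b * ‖w - y₀‖) := by
    intro w
    refine (hgb w).trans ?_
    rw [mul_assoc, ← Real.exp_add, ← mul_add]
    gcongr
    calc ‖w‖ = ‖y₀ + (w - y₀)‖ := by congr 1; abel
      _ ≤ _ := norm_add_le _ _
  have hbnd_int : Integrable (fun w : E => (B * Real.exp (b * ‖y₀‖) * (2 * A *
      Real.exp ((a + 1) ^ 2) * Real.exp (1 / 4))) *
      (Real.exp (b * ‖w - y₀‖) * Real.exp (-(1 / 8) * ‖w - y₀‖ ^ 2))) :=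
    ((integrable_exp_mul_exp_neg_sq (E := E) b (b := 1 / 8) (by norm_num)).comp_sub_right
      y₀).const_mul _
  refine hasFDerivAt_integral_of_dominated_of_fderiv_le
    (F' := fun y w => g w • k' (w - y)) (Metric.ball_mem_nhds y₀ one_pos)
    (Eventually.of_forall fun y => ?_) ?_ ?_ (Eventually.of_forall fun w y hy => ?_) hbnd_int
    (Eventually.of_forall fun w y _ => ?_)
  · exact (Continuous.mul (by fun_prop) hg).aestronglyMeasurable
  · refine ((integrable_exp_mul_exp_neg_sq (E := E) (a + b) (b := 1 / 2) (by norm_num)).comp_sub_right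
      y₀ |>.const_mul (A * (B * Real.exp (b * ‖y₀‖)))).mono'
      (Continuous.mul (by fun_prop) hg).aestronglyMeasurable (Eventually.of_forall fun w => ?_)
    simp only [k]
    rw [norm_mul, norm_mul, Real.norm_of_nonneg (Real.exp_pos _).le]
    calc _ ≤ Real.exp (-(1 / 2) * ‖w - y₀‖ ^ 2) * (A * Real.exp (a * ‖w - y₀‖)) *
          (B * Real.exp (b * ‖y₀‖) * Real.exp (b * ‖w - y₀‖)) := by
          gcongr
          · exact hp.norm_le _
          · exact hexpg w
      _ = _ := by rw [add_mul a b, Real.exp_add]; ring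
  · exact (Continuous.smul hg (by fun_prop)).aestronglyMeasurable
  · have hy' : ‖y - y₀‖ < 1 := by simpa [dist_eq_norm] using hy
    have hr : ‖w - y₀‖ ≤ ‖w - y‖ + 1 := by
      calc ‖w - y₀‖ = ‖(w - y) + (y - y₀)‖ := by congr 1; abel
        _ ≤ _ := (norm_add_le _ _).trans (by linarith)
    have hk : ‖k' (w - y)‖ ≤ 2 * A * Real.exp ((a + 1) ^ 2) * Real.exp (1 / 4) *
        Real.exp (-(1 / 8) * ‖w - y₀‖ ^ 2) := by
      simp only [k']
      rw [norm_smul, Real.norm_of_nonneg (Real.exp_pos _).le]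
      have h1 := exp_mul_exp_neg_sq_le (a + 1) (1 / 2) ‖w - y‖ (by norm_num)
      have h2 : Real.exp (-(1 / 2 / 2) * ‖w - y‖ ^ 2) ≤
          Real.exp (1 / 4) * Real.exp (-(1 / 8) * ‖w - y₀‖ ^ 2) := by
        rw [← Real.exp_add]
        refine Real.exp_le_exp.2 ?_
        nlinarith [norm_nonneg (w - y), norm_nonneg (w - y₀), sq_nonneg (‖w - y‖ - 1)]
      have h3 : (a + 1) ^ 2 / (2 * (1 / 2)) = (a + 1) ^ 2 := by ring
      rw [h3] at h1
      calc _ ≤ Real.exp (-(1 / 2) * ‖w - y‖ ^ 2) * (2 * A * Real.exp ((a + 1) * ‖w - y‖)) := by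
            gcongr; exact hqb _
        _ = 2 * A * (Real.exp ((a + 1) * ‖w - y‖) * Real.exp (-(1 / 2) * ‖w - y‖ ^ 2)) := by ring
        _ ≤ 2 * A * (Real.exp ((a + 1) ^ 2) *
            (Real.exp (1 / 4) * Real.exp (-(1 / 8) * ‖w - y₀‖ ^ 2))) :=
            mul_le_mul_of_nonneg_left
              (h1.trans (mul_le_mul_of_nonneg_left h2 (Real.exp_pos _).le)) (by positivity)
        _ = _ := by ring
    rw [norm_smul]
    calc _ ≤ (B * Real.exp (b * ‖y₀‖) * Real.exp (b * ‖w - y₀‖)) * _ :=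
          mul_le_mul (hexpg w) hk (norm_nonneg _) (by positivity)
      _ = _ := by ring
  · have h1 : HasFDerivAt k (-(k' (w - y))) (w - y) := hasFDerivAt_exp_neg_norm_sq_mul (hp.hasFDerivAt (w - y))
    have h2 : HasFDerivAt (fun y : E => w - y) (-ContinuousLinearMap.id ℝ E) y :=
      (hasFDerivAt_id y).const_sub w
    have h3 := (h1.comp y h2).mul_const (g w)
    refine h3.congr_fderiv ?_
    congr 1
    ext v
    simp

end Shift

section Semigroup

variable {E : Type*} [NormedAddCommGroup E] [InnerProductSpace ℝ E] [FiniteDimensional ℝ E]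
  [MeasurableSpace E] [BorelSpace E]

lemma IsGaussianWeight.integral_dual_eq_zero {p : E → ℝ} {p' : E → E →L[ℝ] ℝ} {A a : ℝ}
    (hp : IsGaussianWeight p p' A a) :
    ∫ z, gaussianDual p p' z ∂(ProbabilityTheory.stdGaussian E) = 0 := by
  have h1 := hasFDerivAt_integral_stdGaussian_shift hp (g := fun _ => 1) continuous_const
    (B := 1) (b := 0) le_rfl (by simp) 0
  simp only [one_smul] at h1
  exact h1.unique (hasFDerivAt_const _ _)

/-- The Gaussian average `E[g(√t x + √(1 - t) Z) q(Z)]`. -/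
noncomputable def mehler {F : Type*} [NormedAddCommGroup F] [NormedSpace ℝ F]
    (g : E → ℝ) (q : E → F) (t : ℝ) (x : E) : F :=
  ∫ z, g (√t • x + √(1 - t) • z) • q z ∂(ProbabilityTheory.stdGaussian E)

lemma stronglyMeasurable_mehler {F : Type*} [NormedAddCommGroup F] [NormedSpace ℝ F]
    [SecondCountableTopology E] {g : E → ℝ} (hg : Continuous g) {q : E → F} (hq : Continuous q)
    (x : E) : StronglyMeasurable fun t => mehler g q t x := by
  refine StronglyMeasurable.integral_prod_right
    (f := fun (t : ℝ) z => g (√t • x + √(1 - t) • z) • q z) (Continuous.stronglyMeasurable ?_)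
  fun_prop

theorem IsGaussianWeight.hasFDerivAt_mehler {p : E → ℝ} {p' : E → E →L[ℝ] ℝ} {A a : ℝ}
    (hp : IsGaussianWeight p p' A a) {g : E → ℝ} (hg : Continuous g) {B b : ℝ} (hb : 0 ≤ b)
    (hgb : ∀ w, ‖g w‖ ≤ B * Real.exp (b * ‖w‖)) {t : ℝ} (ht1 : t < 1) (x : E) :
    HasFDerivAt (mehler g p t) ((√t / √(1 - t)) • mehler g (gaussianDual p p') t x) x := by
  have hs : 0 < √(1 - t) := Real.sqrt_pos.2 (by linarith)
  have h1 := hasFDerivAt_integral_stdGaussian_shift hp (g := fun w => g (√(1 - t) • w))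
    (by fun_prop) (B := B) (b := b * √(1 - t)) (by positivity)
    (fun w => by
      refine (hgb _).trans_eq ?_
      rw [norm_smul, Real.norm_of_nonneg hs.le, mul_assoc])
    ((√t / √(1 - t)) • x)
  have h2 : HasFDerivAt (fun x : E => (√t / √(1 - t)) • x)
      ((√t / √(1 - t)) • ContinuousLinearMap.id ℝ E) x :=
    (hasFDerivAt_id x).fun_const_smul _
  have h3 := h1.comp x h2
  have h4 : ∀ x z : E, √(1 - t) • (z + (√t / √(1 - t)) • x) = √t • x + √(1 - t) • z := by
    intro x z
    rw [smul_add, smul_smul, mul_div_cancel₀ _ hs.ne', add_comm]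
  simp only [Function.comp_def, h4] at h3
  have h5 : mehler g p t =
      fun x => ∫ z, p z * g (√t • x + √(1 - t) • z) ∂(ProbabilityTheory.stdGaussian E) := by
    ext x
    simp only [mehler, smul_eq_mul, mul_comm (g _)]
  rw [h5]
  refine h3.congr_fderiv ?_
  ext v
  simp [mehler]

end Semigroup

section Holder

variable {d : ℕ} {α C : ℝ} {g : EuclideanSpace ℝ (Fin d) → ℝ}

lemma HolderConst.continuous (hα : 0 < α) (hg : HolderConst α C g) : Continuous g := by
  refine continuous_iff_continuousAt.2 fun x => ?_
  rw [ContinuousAt, tendsto_iff_dist_tendsto_zero]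
  have h1 : Tendsto (fun y => C * dist y x ^ α) (𝓝 x) (𝓝 0) := by
    have : ContinuousAt (fun y => C * dist y x ^ α) x :=
      (ContinuousAt.rpow_const (by fun_prop) (Or.inr hα.le)).const_mul C
    simpa [ContinuousAt, Real.zero_rpow hα.ne'] using this
  exact squeeze_zero (fun _ => dist_nonneg) (fun y => hg y x) h1

lemma rpow_le_exp {r : ℝ} (hr : 0 ≤ r) (hα : 0 < α) (hα1 : α ≤ 1) : r ^ α ≤ Real.exp r := by
  rcases le_total r 1 with h | h
  · exact (Real.rpow_le_one hr h hα.le).trans (Real.one_le_exp hr)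
  · calc r ^ α ≤ r ^ (1 : ℝ) := Real.rpow_le_rpow_of_exponent_le h hα1
      _ = r := Real.rpow_one r
      _ ≤ Real.exp r := by linarith [Real.add_one_le_exp r]

lemma HolderConst.norm_le (hα : 0 < α) (hα1 : α ≤ 1) (hC : 0 ≤ C) (hg : HolderConst α C g)
    (w : EuclideanSpace ℝ (Fin d)) : ‖g w‖ ≤ (‖g 0‖ + C) * Real.exp (1 * ‖w‖) := by
  have h1 : ‖g w‖ ≤ ‖g 0‖ + ‖g w - g 0‖ := by
    calc ‖g w‖ = ‖g 0 + (g w - g 0)‖ := by congr 1; ring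
      _ ≤ _ := norm_add_le _ _
  have h2 : ‖g w - g 0‖ ≤ C * ‖w‖ ^ α := by simpa using hg w 0
  have h3 : C * ‖w‖ ^ α ≤ C * Real.exp ‖w‖ :=
    mul_le_mul_of_nonneg_left (rpow_le_exp (norm_nonneg w) hα hα1) hC
  have h4 : ‖g 0‖ ≤ ‖g 0‖ * Real.exp ‖w‖ :=
    le_mul_of_one_le_right (norm_nonneg _) (Real.one_le_exp (norm_nonneg w))
  rw [one_mul, add_mul]
  linarith

variable {F : Type*} [NormedAddCommGroup F] {q : EuclideanSpace ℝ (Fin d) → F} {A a : ℝ}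

lemma integrable_rpow_norm_mul (hα : 0 < α) (hα1 : α ≤ 1) (hq : Continuous q)
    (hqb : ∀ z, ‖q z‖ ≤ A * Real.exp (a * ‖z‖)) :
    Integrable (fun z => ‖z‖ ^ α * ‖q z‖)
      (ProbabilityTheory.stdGaussian (EuclideanSpace ℝ (Fin d))) := by
  refine integrable_stdGaussian_of_norm_le (A := A) (a := 1 + a) ?_ fun z => ?_
  · exact ((continuous_norm.rpow_const fun _ => Or.inr hα.le).mul hq.norm).aestronglyMeasurable
  · rw [norm_mul, norm_norm, Real.norm_of_nonneg (Real.rpow_nonneg (norm_nonneg _) _)]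
    calc _ ≤ Real.exp ‖z‖ * (A * Real.exp (a * ‖z‖)) :=
          mul_le_mul (rpow_le_exp (norm_nonneg _) hα hα1) (hqb z) (norm_nonneg _)
            (Real.exp_pos _).le
      _ = _ := by rw [add_mul, one_mul, Real.exp_add]; ring

variable [NormedSpace ℝ F] [SecondCountableTopologyEither (EuclideanSpace ℝ (Fin d)) F]

lemma HolderConst.integrable_smul (hα : 0 < α) (hα1 : α ≤ 1) (hC : 0 ≤ C)
    (hg : HolderConst α C g) (hq : Continuous q) (hqb : ∀ z, ‖q z‖ ≤ A * Real.exp (a * ‖z‖))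
    (r s : ℝ) (x : EuclideanSpace ℝ (Fin d)) :
    Integrable (fun z => g (r • x + s • z) • q z)
      (ProbabilityTheory.stdGaussian (EuclideanSpace ℝ (Fin d))) := by
  have hgc := hg.continuous hα
  refine integrable_stdGaussian_of_norm_le
    (A := (‖g 0‖ + C) * Real.exp ‖r • x‖ * A) (a := |s| + a) ?_ fun z => ?_
  · exact (Continuous.smul (by fun_prop) hq).aestronglyMeasurable
  · rw [norm_smul]
    have h1 : ‖r • x + s • z‖ ≤ ‖r • x‖ + |s| * ‖z‖ := by
      refine (norm_add_le _ _).trans_eq ?_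
      rw [norm_smul s z, Real.norm_eq_abs]
    have h2 : ‖g (r • x + s • z)‖ ≤
        (‖g 0‖ + C) * (Real.exp ‖r • x‖ * Real.exp (|s| * ‖z‖)) := by
      refine (hg.norm_le hα hα1 hC _).trans ?_
      rw [one_mul, ← Real.exp_add]
      gcongr
    calc _ ≤ (‖g 0‖ + C) * (Real.exp ‖r • x‖ * Real.exp (|s| * ‖z‖)) *
          (A * Real.exp (a * ‖z‖)) := mul_le_mul h2 (hqb z) (norm_nonneg _) (by positivity)
      _ = _ := by rw [add_mul |s|, Real.exp_add]; ring

/-- Smoothing estimate: against a centred weight `q`, an `α`-Hölder function at scale `s` only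
contributes `s ^ α`. -/
lemma HolderConst.norm_integral_smul_le (hα : 0 < α) (hα1 : α ≤ 1) (hC : 0 ≤ C)
    (hg : HolderConst α C g) (hq : Continuous q) (hqb : ∀ z, ‖q z‖ ≤ A * Real.exp (a * ‖z‖))
    (hq0 : ∫ z, q z ∂(ProbabilityTheory.stdGaussian (EuclideanSpace ℝ (Fin d))) = 0)
    (r : ℝ) {s : ℝ} (hs : 0 ≤ s) (x : EuclideanSpace ℝ (Fin d)) :
    ‖∫ z, g (r • x + s • z) • q z
        ∂(ProbabilityTheory.stdGaussian (EuclideanSpace ℝ (Fin d)))‖ ≤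
      C * s ^ α * ∫ z, ‖z‖ ^ α * ‖q z‖
        ∂(ProbabilityTheory.stdGaussian (EuclideanSpace ℝ (Fin d))) := by
  have hqi : Integrable q (ProbabilityTheory.stdGaussian (EuclideanSpace ℝ (Fin d))) :=
    integrable_stdGaussian_of_norm_le hq.aestronglyMeasurable hqb
  have h1 : ∫ z, g (r • x + s • z) • q z
        ∂(ProbabilityTheory.stdGaussian (EuclideanSpace ℝ (Fin d))) =
      ∫ z, (g (r • x + s • z) - g (r • x)) • q z
        ∂(ProbabilityTheory.stdGaussian (EuclideanSpace ℝ (Fin d))) := by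
    simp_rw [sub_smul]
    rw [integral_sub (hg.integrable_smul hα hα1 hC hq hqb r s x) (hqi.fun_smul _), integral_smul, hq0,
      smul_zero, sub_zero]
  rw [h1, ← integral_const_mul]
  refine norm_integral_le_of_norm_le ((integrable_rpow_norm_mul hα hα1 hq hqb).const_mul _)
    (Eventually.of_forall fun z => ?_)
  rw [norm_smul]
  have h2 : ‖g (r • x + s • z) - g (r • x)‖ ≤ C * (s ^ α * ‖z‖ ^ α) := by
    refine (hg _ _).trans_eq ?_
    rw [dist_eq_norm, add_sub_cancel_left, norm_smul, Real.norm_of_nonneg hs,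
      Real.mul_rpow hs (norm_nonneg _)]
  calc _ ≤ C * (s ^ α * ‖z‖ ^ α) * ‖q z‖ := mul_le_mul_of_nonneg_right h2 (norm_nonneg _)
    _ = _ := by ring

end Holder

section Outer

lemma integrableOn_one_sub {f : ℝ → ℝ} (hf : IntegrableOn f (Ioo 0 1)) :
    IntegrableOn (fun t => f (1 - t)) (Ioo 0 1) := by
  rw [← intervalIntegrable_iff_integrableOn_Ioo_of_le zero_le_one] at hf ⊢
  simpa using (hf.comp_sub_left 1).symm

lemma integrableOn_rpow_Ioo {r : ℝ} (hr : -1 < r) :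
    IntegrableOn (fun t : ℝ => t ^ r) (Ioo 0 1) := by
  rw [← intervalIntegrable_iff_integrableOn_Ioo_of_le zero_le_one]
  exact intervalIntegral.intervalIntegrable_rpow' hr

lemma one_div_two_mul_sqrt_rpow {s : ℝ} (hs : 0 < s) (α : ℝ) :
    1 / (2 * s) * √s ^ α = 1 / 2 * s ^ (α / 2 - 1) := by
  rw [Real.sqrt_eq_rpow, ← Real.rpow_mul hs.le, Real.rpow_sub_one hs.ne']
  field_simp

lemma integrableOn_one_div_two_mul_sqrt_rpow {α : ℝ} (hα : 0 < α) :
    IntegrableOn (fun s : ℝ => 1 / (2 * s) * √s ^ α) (Ioo 0 1) := by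
  refine IntegrableOn.congr_fun ((integrableOn_rpow_Ioo (r := α / 2 - 1) (by linarith)).const_mul
    (1 / 2)) (fun s hs => ?_) measurableSet_Ioo
  exact (one_div_two_mul_sqrt_rpow hs.1 α).symm

lemma one_div_two_mul_sqrt_div {t : ℝ} (ht : t ∈ Ioo (0 : ℝ) 1) :
    1 / (2 * t) * (√t / √(1 - t)) * (√t / √(1 - t)) = 1 / (2 * (1 - t)) := by
  have h0 := ht.1
  have h1 : 0 < 1 - t := sub_pos.2 ht.2
  rw [mul_assoc, div_mul_div_comm, Real.mul_self_sqrt h0.le, Real.mul_self_sqrt h1.le]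
  field_simp

lemma integrableOn_one_div_two_mul_sqrt_div {α : ℝ} (hα : 0 < α) :
    IntegrableOn (fun t : ℝ => 1 / (2 * t) * (√t / √(1 - t)) * √(1 - t) ^ α) (Ioo 0 1) := by
  have h1 := integrableOn_rpow_Ioo (r := -(1 / 2)) (by norm_num)
  have h2 := (h1.add (integrableOn_one_sub h1)).const_mul (1 / 2)
  refine h2.mono' (Measurable.aestronglyMeasurable (by fun_prop)) ?_
  refine (ae_restrict_iff' measurableSet_Ioo).2 (Eventually.of_forall fun t ht => ?_)
  have h0 := ht.1
  have h1 : 0 < 1 - t := sub_pos.2 ht.2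
  have ht' : 0 < √t := Real.sqrt_pos.2 h0
  have hs' : 0 < √(1 - t) := Real.sqrt_pos.2 h1
  have ht2 : √t ^ 2 = t := Real.sq_sqrt h0.le
  have hs2 : √(1 - t) ^ 2 = 1 - t := Real.sq_sqrt h1.le
  have h4 : √(1 - t) ^ α ≤ 1 :=
    Real.rpow_le_one hs'.le (Real.sqrt_le_one.2 (by linarith)) hα.le
  rw [Real.norm_of_nonneg (by positivity)]
  simp only [Pi.add_apply]
  rw [Real.rpow_neg h0.le, Real.rpow_neg h1.le, ← Real.sqrt_eq_rpow, ← Real.sqrt_eq_rpow]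
  calc _ ≤ 1 / (2 * t) * (√t / √(1 - t)) * 1 := by gcongr
    _ = 1 / 2 * (√t ^ 2 + √(1 - t) ^ 2) / (√t * √(1 - t)) := by
        rw [ht2, hs2]
        nth_rewrite 1 [← ht2]
        field_simp
        ring
    _ ≤ 1 / 2 * ((√t)⁻¹ + (√(1 - t))⁻¹) := by
        have h5 : √t ≤ 1 := Real.sqrt_le_one.2 ht.2.le
        have h6 : √(1 - t) ≤ 1 := Real.sqrt_le_one.2 (by linarith)
        rw [div_le_iff₀ (by positivity)]
        have h7 : 1 / 2 * ((√t)⁻¹ + (√(1 - t))⁻¹) * (√t * √(1 - t)) =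
          1 / 2 * (√(1 - t) + √t) := by field_simp
        rw [h7]
        nlinarith

variable {d : ℕ} {α C : ℝ} {g : EuclideanSpace ℝ (Fin d) → ℝ}

/-- Differentiation of time integrals of Gaussian averages of a Hölder function. -/
theorem HolderConst.hasFDerivAt_integral_mehler (hα : 0 < α) (hα1 : α ≤ 1) (hC : 0 ≤ C)
    (hg : HolderConst α C g) {p : EuclideanSpace ℝ (Fin d) → ℝ}
    {p' : EuclideanSpace ℝ (Fin d) → EuclideanSpace ℝ (Fin d) →L[ℝ] ℝ} {A a : ℝ}
    (hp : IsGaussianWeight p p' A a) {c : ℝ → ℝ} (hc : Measurable c)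
    (hint : ∀ x, IntegrableOn (fun t => c t * mehler g p t x) (Ioo 0 1))
    (hbd : IntegrableOn (fun t => c t * (√t / √(1 - t)) * √(1 - t) ^ α) (Ioo 0 1))
    (x : EuclideanSpace ℝ (Fin d)) :
    HasFDerivAt (fun x => ∫ t in Ioo 0 1, c t * mehler g p t x)
      (∫ t in Ioo 0 1, (c t * (√t / √(1 - t))) • mehler g (gaussianDual p p') t x) x := by
  have hgc := hg.continuous hα
  refine hasFDerivAt_integral_of_dominated_of_fderiv_le
    (F' := fun x t => (c t * (√t / √(1 - t))) • mehler g (gaussianDual p p') t x)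
    (bound := fun t => ‖c t * (√t / √(1 - t)) * √(1 - t) ^ α‖ *
      (C * ∫ z, ‖z‖ ^ α * ‖gaussianDual p p' z‖
        ∂(ProbabilityTheory.stdGaussian (EuclideanSpace ℝ (Fin d)))))
    (univ_mem) (Eventually.of_forall fun y => (hint y).1) (hint x) ?_ ?_ (hbd.norm.mul_const _) ?_
  · have hm : Measurable fun t => c t * (√t / √(1 - t)) := by fun_prop
    exact (hm.stronglyMeasurable.smul
      (stronglyMeasurable_mehler hgc hp.continuous_dual x)).aestronglyMeasurable
  · refine (ae_restrict_iff' measurableSet_Ioo).2 (Eventually.of_forall fun t ht y _ => ?_)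
    rw [norm_smul, norm_mul (_ * _) (√(1 - t) ^ α),
      Real.norm_of_nonneg (Real.rpow_nonneg (Real.sqrt_nonneg _) _), mul_assoc]
    refine mul_le_mul_of_nonneg_left ?_ (norm_nonneg _)
    refine (hg.norm_integral_smul_le hα hα1 hC hp.continuous_dual hp.norm_dual_le
      hp.integral_dual_eq_zero √t (Real.sqrt_nonneg (1 - t)) y).trans_eq ?_
    ring
  · refine (ae_restrict_iff' measurableSet_Ioo).2 (Eventually.of_forall fun t ht y _ => ?_)
    have := (hp.hasFDerivAt_mehler hgc zero_le_one (hg.norm_le hα hα1 hC) ht.2 y).const_mul (c t)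
    refine this.congr_fderiv ?_
    rw [smul_smul]

lemma sqrt_add_sqrt_one_sub {t : ℝ} (ht : t ∈ Ioo (0 : ℝ) 1) : 1 ≤ √t + √(1 - t) := by
  have ht2 : √t ^ 2 = t := Real.sq_sqrt ht.1.le
  have hs2 : √(1 - t) ^ 2 = 1 - t := Real.sq_sqrt (sub_nonneg.2 ht.2.le)
  nlinarith [Real.sqrt_nonneg t, Real.sqrt_nonneg (1 - t)]

lemma HolderConst.integrableOn_one_div_mul_mehler_one (hα : 0 < α) (hα1 : α ≤ 1) (hC : 0 ≤ C)
    (hg : HolderConst α C g)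
    (hg0 : ∫ z, g z ∂(ProbabilityTheory.stdGaussian (EuclideanSpace ℝ (Fin d))) = 0)
    (x : EuclideanSpace ℝ (Fin d)) :
    IntegrableOn (fun t => 1 / (2 * t) * mehler g (fun _ => (1 : ℝ)) t x) (Ioo 0 1) := by
  have hgc := hg.continuous hα
  have hq : Continuous (fun _ : EuclideanSpace ℝ (Fin d) => (1 : ℝ)) := continuous_const
  have hqb : ∀ z : EuclideanSpace ℝ (Fin d), ‖(1 : ℝ)‖ ≤ 1 * Real.exp (0 * ‖z‖) := by simp
  have hK : Integrable (fun z => (‖x‖ + ‖z‖) ^ α)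
      (ProbabilityTheory.stdGaussian (EuclideanSpace ℝ (Fin d))) := by
    refine integrable_stdGaussian_of_norm_le (A := Real.exp ‖x‖) (a := 1) ?_ fun z => ?_
    · exact (Continuous.rpow_const (by fun_prop) fun _ => Or.inr hα.le).aestronglyMeasurable
    · rw [Real.norm_of_nonneg (by positivity), one_mul, ← Real.exp_add]
      exact rpow_le_exp (by positivity) hα hα1
  refine ((integrableOn_one_div_two_mul_sqrt_rpow hα).mul_const
    (C * ∫ z, (‖x‖ + ‖z‖) ^ α
      ∂(ProbabilityTheory.stdGaussian (EuclideanSpace ℝ (Fin d))))).mono' ?_ ?_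
  · have hm : Measurable fun t : ℝ => 1 / (2 * t) := by fun_prop
    exact (hm.stronglyMeasurable.mul (stronglyMeasurable_mehler hgc hq x)).aestronglyMeasurable
  · refine (ae_restrict_iff' measurableSet_Ioo).2 (Eventually.of_forall fun t ht => ?_)
    have h0 := ht.1
    rw [norm_mul, Real.norm_of_nonneg (by positivity : 0 ≤ 1 / (2 * t)), mul_assoc]
    refine mul_le_mul_of_nonneg_left ?_ (by positivity)
    have h1 : mehler g (fun _ => (1 : ℝ)) t x = ∫ z, (g (√t • x + √(1 - t) • z) - g z)
        ∂(ProbabilityTheory.stdGaussian (EuclideanSpace ℝ (Fin d))) := by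
      have ha := hg.integrable_smul hα hα1 hC hq hqb √t √(1 - t) x
      have hb := hg.integrable_smul hα hα1 hC hq hqb 0 1 x
      simp only [smul_eq_mul, mul_one, zero_smul, one_smul, zero_add] at ha hb
      rw [integral_sub ha hb, hg0, sub_zero]
      simp [mehler]
    rw [h1, ← mul_assoc, ← integral_const_mul]
    refine norm_integral_le_of_norm_le (hK.const_mul _) (Eventually.of_forall fun z => ?_)
    have h2 : dist (√t • x + √(1 - t) • z) z ≤ √t * (‖x‖ + ‖z‖) := by
      have h3 : √t • x + √(1 - t) • z - z = √t • x - (1 - √(1 - t)) • z := by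
        rw [sub_smul, one_smul]; abel
      have h4 : √(1 - t) ≤ 1 := Real.sqrt_le_one.2 (by linarith)
      rw [dist_eq_norm, h3]
      refine (norm_sub_le _ _).trans ?_
      rw [norm_smul, norm_smul, Real.norm_of_nonneg (Real.sqrt_nonneg t),
        Real.norm_of_nonneg (by linarith), mul_add]
      gcongr
      linarith [sqrt_add_sqrt_one_sub ht]
    calc ‖g (√t • x + √(1 - t) • z) - g z‖ ≤ C * dist (√t • x + √(1 - t) • z) z ^ α := hg _ _
      _ ≤ C * (√t * (‖x‖ + ‖z‖)) ^ α := by gcongr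
      _ = √t ^ α * C * (‖x‖ + ‖z‖) ^ α := by
        rw [Real.mul_rpow (Real.sqrt_nonneg _) (by positivity)]; ring

end Outer

section Hessian

variable {d : ℕ} {α C : ℝ} {g : EuclideanSpace ℝ (Fin d) → ℝ}

/-- A continuous weight of exponential growth which is centred under the standard Gaussian. -/
structure IsCentredWeight {F : Type*} [NormedAddCommGroup F] [NormedSpace ℝ F]
    (q : EuclideanSpace ℝ (Fin d) → F) : Prop where
  continuous : Continuous q
  exists_norm_le : ∃ A a : ℝ, ∀ z, ‖q z‖ ≤ A * Real.exp (a * ‖z‖)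
  integral_eq_zero : ∫ z, q z ∂(ProbabilityTheory.stdGaussian (EuclideanSpace ℝ (Fin d))) = 0

lemma IsGaussianWeight.isCentredWeight_dual {p : EuclideanSpace ℝ (Fin d) → ℝ}
    {p' : EuclideanSpace ℝ (Fin d) → EuclideanSpace ℝ (Fin d) →L[ℝ] ℝ} {A a : ℝ}
    (hp : IsGaussianWeight p p' A a) : IsCentredWeight (gaussianDual p p') :=
  ⟨hp.continuous_dual, ⟨_, _, hp.norm_dual_le⟩, hp.integral_dual_eq_zero⟩

lemma IsCentredWeight.apply {q : EuclideanSpace ℝ (Fin d) → EuclideanSpace ℝ (Fin d) →L[ℝ] ℝ}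
    (hq : IsCentredWeight q) (v : EuclideanSpace ℝ (Fin d)) :
    IsCentredWeight fun z => q z v := by
  obtain ⟨hc, ⟨A, a, hb⟩, h0⟩ := hq
  refine ⟨hc.clm_apply continuous_const, ⟨A * ‖v‖, a, fun z => ?_⟩, ?_⟩
  · calc ‖q z v‖ ≤ ‖q z‖ * ‖v‖ := (q z).le_opNorm v
      _ ≤ A * Real.exp (a * ‖z‖) * ‖v‖ := by gcongr; exact hb z
      _ = _ := by ring
  · rw [← ContinuousLinearMap.integral_apply
      (integrable_stdGaussian_of_norm_le hc.aestronglyMeasurable hb), h0, zero_apply]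

lemma HolderConst.integrableOn_smul_mehler {F : Type*} [NormedAddCommGroup F] [NormedSpace ℝ F]
    [SecondCountableTopologyEither (EuclideanSpace ℝ (Fin d)) F]
    (hα : 0 < α) (hα1 : α ≤ 1) (hC : 0 ≤ C) (hg : HolderConst α C g)
    {q : EuclideanSpace ℝ (Fin d) → F} (hq : IsCentredWeight q) {c : ℝ → ℝ} (hc : Measurable c)
    (hbd : IntegrableOn (fun t => c t * √(1 - t) ^ α) (Ioo 0 1))
    (x : EuclideanSpace ℝ (Fin d)) :
    IntegrableOn (fun t => c t • mehler g q t x) (Ioo 0 1) := by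
  obtain ⟨hqc, ⟨A, a, hb⟩, h0⟩ := hq
  refine (hbd.norm.mul_const (C * ∫ z, ‖z‖ ^ α * ‖q z‖
        ∂(ProbabilityTheory.stdGaussian (EuclideanSpace ℝ (Fin d))))).mono' ?_
    (Eventually.of_forall fun t => ?_)
  · exact (hc.stronglyMeasurable.smul
      (stronglyMeasurable_mehler (hg.continuous hα) hqc x)).aestronglyMeasurable
  · rw [norm_smul, norm_mul (c t),
      Real.norm_of_nonneg (Real.rpow_nonneg (Real.sqrt_nonneg _) _), mul_assoc]
    refine mul_le_mul_of_nonneg_left ?_ (norm_nonneg _)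
    refine (hg.norm_integral_smul_le hα hα1 hC hqc hb h0 √t
      (Real.sqrt_nonneg (1 - t)) x).trans_eq ?_
    ring

lemma HolderConst.mehler_apply (hα : 0 < α) (hα1 : α ≤ 1) (hC : 0 ≤ C) (hg : HolderConst α C g)
    {q : EuclideanSpace ℝ (Fin d) → EuclideanSpace ℝ (Fin d) →L[ℝ] ℝ}
    (hq : IsCentredWeight q) (t : ℝ) (x v : EuclideanSpace ℝ (Fin d)) :
    mehler g q t x v = mehler g (fun z => q z v) t x := by
  obtain ⟨hqc, ⟨A, a, hb⟩, -⟩ := hq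
  rw [mehler, ContinuousLinearMap.integral_apply
    (hg.integrable_smul hα hα1 hC hqc hb √t √(1 - t) x)]
  rfl

theorem HolderConst.fderiv_neg_integral_mehler (hα : 0 < α) (hα1 : α ≤ 1) (hC : 0 ≤ C)
    (hg : HolderConst α C g) {p : EuclideanSpace ℝ (Fin d) → ℝ}
    {p' : EuclideanSpace ℝ (Fin d) → EuclideanSpace ℝ (Fin d) →L[ℝ] ℝ} {A a : ℝ}
    (hp : IsGaussianWeight p p' A a) {c : ℝ → ℝ} (hc : Measurable c)
    (hint : ∀ x, IntegrableOn (fun t => c t * mehler g p t x) (Ioo 0 1))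
    (hbd : IntegrableOn (fun t => c t * (√t / √(1 - t)) * √(1 - t) ^ α) (Ioo 0 1))
    (x v : EuclideanSpace ℝ (Fin d)) :
    fderiv ℝ (fun x => -∫ t in Ioo 0 1, c t * mehler g p t x) x v =
      -∫ t in Ioo 0 1, c t * (√t / √(1 - t)) *
        mehler g (fun z => gaussianDual p p' z v) t x := by
  rw [(hg.hasFDerivAt_integral_mehler hα hα1 hC hp hc hint hbd x).fun_neg.fderiv, neg_apply,
    ContinuousLinearMap.integral_apply (hg.integrableOn_smul_mehler hα hα1 hC
      hp.isCentredWeight_dual (by fun_prop) hbd x)]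
  simp_rw [smul_apply, hg.mehler_apply hα hα1 hC hp.isCentredWeight_dual, smul_eq_mul]

lemma isGaussianWeight_one :
    IsGaussianWeight (fun _ : EuclideanSpace ℝ (Fin d) => (1 : ℝ)) (fun _ => 0) 1 0 where
  hasFDerivAt _ := hasFDerivAt_const _ _
  continuous_deriv := continuous_const
  norm_le _ := by simp
  norm_deriv_le _ := by simp

lemma isGaussianWeight_coord (j : Fin d) :
    IsGaussianWeight (fun z : EuclideanSpace ℝ (Fin d) => z j)
      (fun _ => EuclideanSpace.proj j) 1 1 where
  hasFDerivAt _ := (EuclideanSpace.proj (𝕜 := ℝ) j).hasFDerivAt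
  continuous_deriv := continuous_const
  norm_le z := by
    have h1 := PiLp.norm_apply_le z j
    have h2 := Real.add_one_le_exp ‖z‖
    rw [one_mul, one_mul]
    linarith
  norm_deriv_le z := by
    have h1 : ‖(EuclideanSpace.proj j : EuclideanSpace ℝ (Fin d) →L[ℝ] ℝ)‖ ≤ 1 :=
      ContinuousLinearMap.opNorm_le_bound _ zero_le_one fun z => by
        simpa using PiLp.norm_apply_le z j
    have h2 : 1 ≤ Real.exp ‖z‖ := Real.one_le_exp (norm_nonneg z)
    rw [one_mul, one_mul]
    linarith

lemma gaussianDual_one_single (j : Fin d) (z : EuclideanSpace ℝ (Fin d)) :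
    gaussianDual (fun _ => 1) (fun _ => 0) z (EuclideanSpace.single j 1) = z j := by
  simp [gaussianDual, EuclideanSpace.inner_single_right]

lemma gaussianDual_coord_single (i j : Fin d) (z : EuclideanSpace ℝ (Fin d)) :
    gaussianDual (fun z => z j) (fun _ => EuclideanSpace.proj j) z (EuclideanSpace.single i 1) =
      z i * z j - (1 : Matrix (Fin d) (Fin d) ℝ) i j := by
  simp only [gaussianDual, sub_apply, smul_apply, innerSL_apply_apply,
    EuclideanSpace.inner_single_right, smul_eq_mul, Matrix.one_apply]
  simp [mul_comm, eq_comm]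

lemma isCentredWeight_hermite (i j : Fin d) :
    IsCentredWeight fun z : EuclideanSpace ℝ (Fin d) =>
      z i * z j - (1 : Matrix (Fin d) (Fin d) ℝ) i j := by
  simp_rw [← gaussianDual_coord_single]
  exact (isGaussianWeight_coord j).isCentredWeight_dual.apply _

lemma stdGaussian_eq (d : ℕ) :
    _root_.stdGaussian d = ProbabilityTheory.stdGaussian (EuclideanSpace ℝ (Fin d)) := by
  rw [← map_pi_eq_stdGaussian]
  rfl

lemma HolderConst.hbar (hg : HolderConst α C g) : HolderConst α C (hbar d g) := by
  intro x y
  simpa [_root_.hbar] using hg x y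

lemma HolderConst.integral_hbar (hα : 0 < α) (hα1 : α ≤ 1) (hC : 0 ≤ C)
    (hg : HolderConst α C g) :
    ∫ z, _root_.hbar d g z ∂(ProbabilityTheory.stdGaussian (EuclideanSpace ℝ (Fin d))) = 0 := by
  have hi : Integrable g (ProbabilityTheory.stdGaussian (EuclideanSpace ℝ (Fin d))) :=
    integrable_stdGaussian_of_norm_le (hg.continuous hα).aestronglyMeasurable
      (hg.norm_le hα hα1 hC)
  simp only [_root_.hbar, stdGaussian_eq]
  rw [integral_sub hi (integrable_const _)]
  simp

lemma steinSol_eq_neg_integral_mehler (h : EuclideanSpace ℝ (Fin d) → ℝ) :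
    steinSol d h = fun x =>
      -∫ t in Ioo 0 1, 1 / (2 * t) * mehler (hbar d h) (fun _ => (1 : ℝ)) t x := by
  ext x
  simp [steinSol, mehler, stdGaussian_eq]

theorem HolderConst.hessEntry_steinSol (hα : 0 < α) (hα1 : α ≤ 1) (hC : 0 ≤ C)
    (hg : HolderConst α C g) (x : EuclideanSpace ℝ (Fin d)) (i j : Fin d) :
    hessEntry (steinSol d g) x i j = -∫ t in Ioo 0 1, 1 / (2 * (1 - t)) *
      mehler (_root_.hbar d g)
        (fun z => z i * z j - (1 : Matrix (Fin d) (Fin d) ℝ) i j) t x := by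
  have hb := hg.hbar
  have hI := integrableOn_one_div_two_mul_sqrt_div hα
  have h1 : pderivI j (steinSol d g) = fun x => -∫ t in Ioo 0 1,
      1 / (2 * t) * (√t / √(1 - t)) * mehler (_root_.hbar d g) (fun z => z j) t x := by
    ext x
    rw [steinSol_eq_neg_integral_mehler, pderivI, hb.fderiv_neg_integral_mehler hα hα1 hC
      isGaussianWeight_one (by fun_prop) (hb.integrableOn_one_div_mul_mehler_one hα hα1 hC
        (hg.integral_hbar hα hα1 hC)) hI]
    simp_rw [gaussianDual_one_single]
  have hcoord : IsCentredWeight fun z : EuclideanSpace ℝ (Fin d) => z j := by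
    simp_rw [← gaussianDual_one_single]
    exact isGaussianWeight_one.isCentredWeight_dual.apply _
  have hJ : IntegrableOn (fun t : ℝ => 1 / (2 * t) * (√t / √(1 - t)) * (√t / √(1 - t)) *
      √(1 - t) ^ α) (Ioo 0 1) := by
    refine (integrableOn_one_sub (integrableOn_one_div_two_mul_sqrt_rpow hα)).congr_fun
      (fun t ht => ?_) measurableSet_Ioo
    rw [one_div_two_mul_sqrt_div ht]
  rw [hessEntry, h1, pderivI, hb.fderiv_neg_integral_mehler hα hα1 hC
    (isGaussianWeight_coord j) (by fun_prop)
    (fun x => hb.integrableOn_smul_mehler hα hα1 hC hcoord (by fun_prop) hI x) hJ]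
  simp_rw [gaussianDual_coord_single]
  congr 1
  refine setIntegral_congr_fun measurableSet_Ioo fun t ht => ?_
  beta_reduce
  rw [one_div_two_mul_sqrt_div ht]

end Hessian

section Moments

variable {d : ℕ}

/-- Moments of the norm of a standard Gaussian vector. -/
theorem integral_rpow_norm_stdGaussian (hd : 1 ≤ d) {p : ℝ} (hp : 0 ≤ p) :
    ∫ z, ‖z‖ ^ p ∂(ProbabilityTheory.stdGaussian (EuclideanSpace ℝ (Fin d))) =
      2 ^ (p / 2) * (Real.Gamma ((p + d) / 2) / Real.Gamma (d / 2)) := by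
  have hd' : (1 : ℝ) ≤ d := by exact_mod_cast hd
  have : Nonempty (Fin d) := ⟨⟨0, hd⟩⟩
  obtain ⟨K, hK⟩ : ∃ K : ℝ, ∀ p : ℝ, 0 ≤ p →
      ∫ z, ‖z‖ ^ p ∂(ProbabilityTheory.stdGaussian (EuclideanSpace ℝ (Fin d))) =
        K * (2 ^ ((p + d) / 2) * Real.Gamma ((p + d) / 2)) := by
    refine ⟨gaussianNorm (EuclideanSpace ℝ (Fin d)) * (d *
      ((volume : Measure (EuclideanSpace ℝ (Fin d))).real (Metric.ball 0 1) * (1 / 2))),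
      fun p hp => ?_⟩
    have h1 : ∫ y in Ioi (0 : ℝ), y ^ (d - 1) • (Real.exp (-(1 / 2) * y ^ 2) • y ^ p) =
        2 ^ ((p + d) / 2) * (1 / 2) * Real.Gamma ((p + d) / 2) := by
      have h2 := integral_rpow_mul_exp_neg_mul_rpow (p := 2) (q := p + d - 1) (b := 1 / 2)
        two_pos (by linarith) (by norm_num)
      rw [sub_add_cancel] at h2
      have h3 : (1 / 2 : ℝ) ^ (-(p + d) / 2) = 2 ^ ((p + d) / 2) := by
        rw [one_div, Real.inv_rpow two_pos.le, ← Real.rpow_neg two_pos.le]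
        congr 1
        ring
      rw [← h3, ← h2]
      refine setIntegral_congr_fun measurableSet_Ioi fun y hy => ?_
      have hy : 0 < y := hy
      rw [smul_eq_mul, smul_eq_mul, Real.rpow_two, show p + d - 1 = ((d - 1 : ℕ) : ℝ) + p by
        rw [Nat.cast_sub hd, Nat.cast_one]; ring, Real.rpow_add hy, Real.rpow_natCast]
      ring
    rw [integral_stdGaussian, integral_fun_norm_addHaar volume
      (fun y : ℝ => Real.exp (-(1 / 2) * y ^ 2) • y ^ p), finrank_euclideanSpace_fin, h1]
    simp only [smul_eq_mul, nsmul_eq_mul]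
    ring
  have h0 := hK 0 le_rfl
  simp only [Real.rpow_zero, zero_add, integral_const, probReal_univ, smul_eq_mul, mul_one] at h0
  have hG : 0 < Real.Gamma ((d : ℝ) / 2) := Real.Gamma_pos_of_pos (by linarith)
  rw [hK p hp, add_div, Real.rpow_add two_pos]
  calc K * (2 ^ (p / 2) * 2 ^ ((d : ℝ) / 2) * Real.Gamma (p / 2 + d / 2))
      = K * (2 ^ ((d : ℝ) / 2) * Real.Gamma (d / 2)) *
          (2 ^ (p / 2) * (Real.Gamma (p / 2 + d / 2) / Real.Gamma (d / 2))) := by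
        field_simp
    _ = _ := by rw [← h0, one_mul]

lemma integral_rpow_norm_add_two_stdGaussian (hd : 1 ≤ d) {p : ℝ} (hp : 0 ≤ p) :
    ∫ z, ‖z‖ ^ (p + 2) ∂(ProbabilityTheory.stdGaussian (EuclideanSpace ℝ (Fin d))) =
      (p + d) * ∫ z, ‖z‖ ^ p ∂(ProbabilityTheory.stdGaussian (EuclideanSpace ℝ (Fin d))) := by
  have hd' : (1 : ℝ) ≤ d := by exact_mod_cast hd
  rw [integral_rpow_norm_stdGaussian hd hp, integral_rpow_norm_stdGaussian hd (by linarith),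
    show (p + 2 + d) / 2 = (p + d) / 2 + 1 by ring, Real.Gamma_add_one (by positivity),
    show (p + 2) / 2 = p / 2 + 1 by ring, Real.rpow_add two_pos, Real.rpow_one]
  ring

/-- The law of `|Z|` together with a one-dimensional projection of `Z` does not depend on the
direction of the projection. -/
lemma integral_inner_norm_stdGaussian_eq {E : Type*} [NormedAddCommGroup E]
    [InnerProductSpace ℝ E] [FiniteDimensional ℝ E] [MeasurableSpace E] [BorelSpace E]
    {F : Type*} [NormedAddCommGroup F] [NormedSpace ℝ F] {u v : E} (huv : ‖u‖ = ‖v‖)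
    (f : ℝ → ℝ → F) :
    ∫ z, f (inner ℝ u z) ‖z‖ ∂(ProbabilityTheory.stdGaussian E) =
      ∫ z, f (inner ℝ v z) ‖z‖ ∂(ProbabilityTheory.stdGaussian E) := by
  let R : E ≃ₗᵢ[ℝ] E := (ℝ ∙ (u - v))ᗮ.reflection
  have hRu : R u = v := Submodule.reflection_sub huv
  have hmap : ∫ z, f (inner ℝ v (R z)) ‖R z‖ ∂(ProbabilityTheory.stdGaussian E) =
      ∫ z, f (inner ℝ v z) ‖z‖ ∂((ProbabilityTheory.stdGaussian E).map R) :=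
    (R.toHomeomorph.measurableEmbedding.integral_map fun z => f (inner ℝ v z) ‖z‖).symm
  rw [← ProbabilityTheory.stdGaussian_map R, ← hmap, ProbabilityTheory.stdGaussian_map R]
  simp_rw [← hRu, LinearIsometryEquiv.inner_map_map, LinearIsometryEquiv.norm_map]

lemma inner_sq_le_mul_exp {E : Type*} [NormedAddCommGroup E] [InnerProductSpace ℝ E] (u z : E) :
    inner ℝ u z ^ 2 ≤ 2 * ‖u‖ ^ 2 * Real.exp (1 * ‖z‖) := by
  have h1 : inner ℝ u z ^ 2 ≤ (‖u‖ * ‖z‖) ^ 2 := sq_le_sq' (by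
    linarith [neg_le_of_abs_le (abs_real_inner_le_norm u z)]) (real_inner_le_norm u z)
  have h2 : ‖z‖ ^ 2 ≤ 2 * Real.exp ‖z‖ := by
    linarith [Real.quadratic_le_exp_of_nonneg (norm_nonneg z), norm_nonneg z]
  rw [one_mul]
  nlinarith [mul_le_mul_of_nonneg_left h2 (sq_nonneg ‖u‖)]

lemma integrable_rpow_norm_mul_inner_sq {α : ℝ} (hα : 0 < α) (hα1 : α ≤ 1)
    (u : EuclideanSpace ℝ (Fin d)) :
    Integrable (fun z => ‖z‖ ^ α * inner ℝ u z ^ 2)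
      (ProbabilityTheory.stdGaussian (EuclideanSpace ℝ (Fin d))) := by
  have h := integrable_rpow_norm_mul hα hα1 (q := fun z => inner ℝ u z ^ 2) (by fun_prop)
    fun z => (Real.norm_of_nonneg (sq_nonneg _)).trans_le (inner_sq_le_mul_exp u z)
  simpa using h

lemma integral_inner_sq_mul_rpow_norm_stdGaussian (hd : 1 ≤ d) {α : ℝ} (hα : 0 < α)
    (hα1 : α ≤ 1) {u : EuclideanSpace ℝ (Fin d)} (hu : ‖u‖ = 1) :
    ∫ z, ‖z‖ ^ α * inner ℝ u z ^ 2
        ∂(ProbabilityTheory.stdGaussian (EuclideanSpace ℝ (Fin d))) =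
      (α + d) / d *
        ∫ z, ‖z‖ ^ α ∂(ProbabilityTheory.stdGaussian (EuclideanSpace ℝ (Fin d))) := by
  have hd' : (1 : ℝ) ≤ d := by exact_mod_cast hd
  have h1 (i : Fin d) : ∫ z, ‖z‖ ^ α * inner ℝ u z ^ 2
        ∂(ProbabilityTheory.stdGaussian (EuclideanSpace ℝ (Fin d))) =
      ∫ z : EuclideanSpace ℝ (Fin d), ‖z‖ ^ α * z i ^ 2
        ∂(ProbabilityTheory.stdGaussian (EuclideanSpace ℝ (Fin d))) := by
    rw [integral_inner_norm_stdGaussian_eq (v := EuclideanSpace.single i (1 : ℝ)) (by simp [hu])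
      fun a b => b ^ α * a ^ 2]
    simp [EuclideanSpace.inner_single_left]
  have h2 : ∫ z, ‖z‖ ^ (α + 2) ∂(ProbabilityTheory.stdGaussian (EuclideanSpace ℝ (Fin d))) =
      ∑ i : Fin d, ∫ z : EuclideanSpace ℝ (Fin d), ‖z‖ ^ α * z i ^ 2
        ∂(ProbabilityTheory.stdGaussian (EuclideanSpace ℝ (Fin d))) := by
    rw [← integral_finsetSum]
    · refine integral_congr_ae (Eventually.of_forall fun z => ?_)
      beta_reduce
      rw [← Finset.mul_sum, ← EuclideanSpace.real_norm_sq_eq, Real.rpow_add_of_nonneg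
        (norm_nonneg z) hα.le two_pos.le, Real.rpow_two]
    · intro i _
      simpa [EuclideanSpace.inner_single_left] using
        integrable_rpow_norm_mul_inner_sq hα hα1 (EuclideanSpace.single i (1 : ℝ))
  simp_rw [← h1] at h2
  rw [integral_rpow_norm_add_two_stdGaussian hd hα.le, Finset.sum_const, Finset.card_univ,
    Fintype.card_fin, nsmul_eq_mul] at h2
  field_simp
  linarith

lemma integrable_sq_sub_one_gaussianReal :
    Integrable (fun x : ℝ => x ^ 2 - 1) (gaussianReal 0 1) :=
  (memLp_id_gaussianReal 2).integrable_sq.sub (integrable_const _)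

lemma integral_sq_sub_one_gaussianReal : ∫ x : ℝ, (x ^ 2 - 1) ∂(gaussianReal 0 1) = 0 := by
  have h := variance_eq_sub (memLp_id_gaussianReal (μ := 0) (v := 1) 2)
  rw [variance_id_gaussianReal] at h
  simp only [id_eq, Pi.pow_apply, integral_id_gaussianReal, NNReal.coe_one] at h
  rw [integral_sub (f := fun x : ℝ => x ^ 2) (memLp_id_gaussianReal 2).integrable_sq
    (integrable_const _)]
  simp only [integral_const, probReal_univ, smul_eq_mul]
  linarith

/-- `E|ξ² - 1| ≤ 1` for a standard Gaussian variable `ξ`. -/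
lemma integral_abs_sq_sub_one_gaussianReal_le : ∫ x, |x ^ 2 - 1| ∂(gaussianReal 0 1) ≤ 1 := by
  have hi := integrable_sq_sub_one_gaussianReal
  have h1 : ∫ x, (Ioc (-1 : ℝ) 1).indicator (fun x => 1 - x ^ 2) x ∂(gaussianReal 0 1) =
      (√(2 * π))⁻¹ * (2 * Real.exp (-1 / 2)) := by
    have h2 : ∫ x in (-1 : ℝ)..1, Real.exp (-x ^ 2 / 2) * (1 - x ^ 2) =
        2 * Real.exp (-1 / 2) := by
      rw [intervalIntegral.integral_eq_sub_of_hasDerivAt (f := fun x => x * Real.exp (-x ^ 2 / 2))]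
      · norm_num
        ring
      · intro x _
        have h := (hasDerivAt_id x).mul (((hasDerivAt_pow 2 x).fun_neg.div_const 2).exp)
        refine h.congr_deriv ?_
        simp
        ring
      · exact (by fun_prop : Continuous _).intervalIntegrable _ _
    rw [integral_gaussianReal_eq_integral_smul one_ne_zero, ← h2,
      intervalIntegral.integral_of_le (by norm_num), ← integral_indicator measurableSet_Ioc,
      ← integral_const_mul]
    congr 1
    ext x
    by_cases hx : x ∈ Ioc (-1 : ℝ) 1
    · simp [hx, gaussianPDFReal_def]
      ring
    · simp [hx]
  have h3 : ∀ x : ℝ, |x ^ 2 - 1| =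
      (x ^ 2 - 1) + 2 * (Ioc (-1 : ℝ) 1).indicator (fun x => 1 - x ^ 2) x := by
    intro x
    by_cases hx : x ∈ Ioc (-1 : ℝ) 1
    · rw [indicator_of_mem hx, abs_of_nonpos (by nlinarith [hx.1, hx.2])]
      ring
    · rw [indicator_of_notMem hx, mul_zero, add_zero, abs_of_nonneg]
      rw [mem_Ioc, not_and_or, not_lt, not_le] at hx
      rcases hx with hx | hx <;> nlinarith
  have hi2 : Integrable ((Ioc (-1 : ℝ) 1).indicator fun x => 1 - x ^ 2) (gaussianReal 0 1) := by
    refine Integrable.indicator ?_ measurableSet_Ioc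
    exact hi.neg.congr (Eventually.of_forall fun x => neg_sub _ _)
  simp_rw [h3]
  rw [integral_add hi (hi2.const_mul 2), integral_sq_sub_one_gaussianReal, integral_const_mul, h1]
  have h4 : (4 * Real.exp (-1 / 2)) ^ 2 ≤ 2 * π := by
    have h5 : Real.exp (-1 / 2) ^ 2 * Real.exp 1 = 1 := by
      rw [← Real.exp_nat_mul, ← Real.exp_add]
      norm_num
    nlinarith [Real.exp_one_gt_d9, Real.pi_gt_three, sq_nonneg (Real.exp (-1 / 2))]
  have h6 : 4 * Real.exp (-1 / 2) ≤ √(2 * π) := Real.le_sqrt_of_sq_le h4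
  have h7 : 0 < √(2 * π) := by positivity
  rw [zero_add, inv_mul_eq_div, ← mul_div_assoc, div_le_one h7]
  linarith

lemma map_innerSL_stdGaussian {E : Type*} [NormedAddCommGroup E]
    [InnerProductSpace ℝ E] [FiniteDimensional ℝ E] [MeasurableSpace E] [BorelSpace E]
    {u : E} (hu : ‖u‖ = 1) :
    (ProbabilityTheory.stdGaussian E).map (innerSL ℝ u) = gaussianReal 0 1 := by
  rw [IsGaussian.map_eq_gaussianReal, integral_strongDual_stdGaussian,
    variance_dual_stdGaussian, innerSL_apply_norm, hu]
  simp

lemma integral_abs_inner_sq_sub_one_stdGaussian_le {E : Type*} [NormedAddCommGroup E]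
    [InnerProductSpace ℝ E] [FiniteDimensional ℝ E] [MeasurableSpace E] [BorelSpace E]
    {u : E} (hu : ‖u‖ = 1) :
    ∫ z, |inner ℝ u z ^ 2 - 1| ∂(ProbabilityTheory.stdGaussian E) ≤ 1 := by
  refine le_trans (le_of_eq ?_) integral_abs_sq_sub_one_gaussianReal_le
  rw [← map_innerSL_stdGaussian hu, integral_map (by fun_prop) (by fun_prop)]
  rfl

lemma isCentredWeight_inner_sq_sub_one {u : EuclideanSpace ℝ (Fin d)} (hu : ‖u‖ = 1) :
    IsCentredWeight fun z => inner ℝ u z ^ 2 - 1 where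
  continuous := by fun_prop
  exists_norm_le := by
    refine ⟨3, 1, fun z => ?_⟩
    have h1 := inner_sq_le_mul_exp u z
    have h2 : 1 ≤ Real.exp (1 * ‖z‖) := Real.one_le_exp (by positivity)
    rw [hu] at h1
    rw [Real.norm_eq_abs, abs_le]
    constructor <;> nlinarith [sq_nonneg (inner ℝ u z : ℝ)]
  integral_eq_zero := by
    rw [← integral_sq_sub_one_gaussianReal, ← map_innerSL_stdGaussian hu,
      integral_map (by fun_prop) (by fun_prop)]
    rfl

lemma integral_rpow_norm_mul_abs_inner_sq_sub_one_le (hd : 1 ≤ d) {α : ℝ} (hα : 0 < α)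
    (hα1 : α ≤ 1) {u : EuclideanSpace ℝ (Fin d)} (hu : ‖u‖ = 1) :
    2 / α * ∫ z, ‖z‖ ^ α * ‖inner ℝ u z ^ 2 - 1‖
        ∂(ProbabilityTheory.stdGaussian (EuclideanSpace ℝ (Fin d))) ≤ C1 α d := by
  have hd' : (1 : ℝ) ≤ d := by exact_mod_cast hd
  have hi1 : Integrable (fun z => ‖z‖ ^ α)
      (ProbabilityTheory.stdGaussian (EuclideanSpace ℝ (Fin d))) := by
    simpa using integrable_rpow_norm_mul (d := d) hα hα1 (q := fun _ => (1 : ℝ))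
      continuous_const (A := 1) (a := 0) (by simp)
  have hi2 := integrable_rpow_norm_mul_inner_sq hα hα1 u
  obtain ⟨hc, ⟨A, a, hb⟩, -⟩ := isCentredWeight_inner_sq_sub_one hu
  have h1 : ∫ z, ‖z‖ ^ α * ‖inner ℝ u z ^ 2 - 1‖
        ∂(ProbabilityTheory.stdGaussian (EuclideanSpace ℝ (Fin d))) ≤
      ∫ z, (‖z‖ ^ α * inner ℝ u z ^ 2 + ‖z‖ ^ α)
        ∂(ProbabilityTheory.stdGaussian (EuclideanSpace ℝ (Fin d))) := by
    refine integral_mono (integrable_rpow_norm_mul hα hα1 hc hb) (hi2.add hi1) fun z => ?_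
    have h2 : ‖(inner ℝ u z : ℝ) ^ 2 - 1‖ ≤ inner ℝ u z ^ 2 + 1 := by
      rw [Real.norm_eq_abs, abs_le]
      constructor <;> linarith [sq_nonneg (inner ℝ u z : ℝ)]
    have h3 := mul_le_mul_of_nonneg_left h2 (Real.rpow_nonneg (norm_nonneg z) α)
    beta_reduce
    linarith
  rw [integral_add hi2 hi1, integral_inner_sq_mul_rpow_norm_stdGaussian hd hα hα1 hu,
    integral_rpow_norm_stdGaussian hd hα.le] at h1
  refine (mul_le_mul_of_nonneg_left h1 (by positivity)).trans_eq ?_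
  rw [C1, Real.rpow_add two_pos, Real.rpow_one]
  field_simp
  ring

end Moments

section Assembly

variable {d : ℕ}

lemma matOpNorm_le_of_isSymm {M : Matrix (Fin d) (Fin d) ℝ} (hM : M.IsSymm) {B : ℝ} (hB : 0 ≤ B)
    (h : ∀ u : EuclideanSpace ℝ (Fin d), ‖u‖ = 1 → |∑ i, ∑ j, u i * u j * M i j| ≤ B) :
    matOpNorm M ≤ B := by
  set T := Matrix.toEuclideanCLM (𝕜 := ℝ) M with hT
  have hsymm : T.toLinearMap.IsSymmetric := by
    rw [← ContinuousLinearMap.isSelfAdjoint_iff_isSymmetric, isSelfAdjoint_iff, hT,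
      ← map_star, Matrix.star_eq_conjTranspose, Matrix.conjTranspose_eq_transpose_of_trivial, hM]
  have hunit (u : EuclideanSpace ℝ (Fin d)) (hu : ‖u‖ = 1) : |T.rayleighQuotient u| ≤ B := by
    refine le_of_eq_of_le ?_ (h u hu)
    rw [ContinuousLinearMap.rayleighQuotient, ContinuousLinearMap.reApplyInnerSelf_apply, hu,
      one_pow, div_one, PiLp.inner_apply]
    simp only [hT, Matrix.ofLp_toEuclideanCLM, Matrix.mulVec, dotProduct, RCLike.inner_apply,
      conj_trivial, RCLike.re_to_real, Finset.mul_sum]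
    congr 1
    refine Finset.sum_congr rfl fun i _ => Finset.sum_congr rfl fun j _ => ?_
    ring
  have hnorm : ‖T‖ ≤ B := by
    rw [ContinuousLinearMap.norm_eq_iSup_rayleighQuotient T hsymm]
    refine Real.iSup_le (fun x => ?_) hB
    rcases eq_or_ne x 0 with rfl | hx
    · simpa using hB
    · have hx' : ‖x‖⁻¹ ≠ 0 := inv_ne_zero (norm_ne_zero_iff.2 hx)
      rw [← T.rayleigh_smul x (c := ‖x‖⁻¹) hx']
      exact hunit _ (norm_smul_inv_norm (𝕜 := ℝ) hx)
  refine Real.sSup_le ?_ hB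
  rintro _ ⟨v, hv, rfl⟩
  calc _ = ‖T v‖ := by rw [hT]; rfl
    _ ≤ ‖T‖ * ‖v‖ := T.le_opNorm v
    _ ≤ B := by rw [hv, mul_one]; exact hnorm

/-- An integral over `(0, 1)` whose integrand is controlled near `1` by an integrable power and
away from `1` by the borderline singularity. -/
lemma abs_integral_Ioo_le_of_rpow_of_inv {F : ℝ → ℝ} (hF : IntegrableOn F (Ioo 0 1))
    {β K L η : ℝ} (hβ : 0 < β) (hη : 0 < η) (hη1 : η ≤ 1)
    (hK : ∀ s ∈ Ioc (0 : ℝ) 1, |F (1 - s)| ≤ K * s ^ (β - 1))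
    (hL : ∀ s ∈ Ioc (0 : ℝ) 1, |F (1 - s)| ≤ L * s⁻¹) :
    |∫ t in Ioo 0 1, F t| ≤ K * (η ^ β / β) - L * Real.log η := by
  have hG : IntervalIntegrable (fun s => F (1 - s)) volume 0 1 := by
    rw [intervalIntegrable_iff_integrableOn_Ioo_of_le zero_le_one]
    exact integrableOn_one_sub hF
  have h1 : ∫ t in Ioo 0 1, F t = ∫ s in (0 : ℝ)..1, F (1 - s) := by
    rw [intervalIntegral.integral_comp_sub_left (fun s => F s) 1, sub_self, sub_zero,
      intervalIntegral.integral_of_le zero_le_one, integral_Ioc_eq_integral_Ioo]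
  have hηmem : η ∈ uIcc (0 : ℝ) 1 := by rw [uIcc_of_le zero_le_one]; exact ⟨hη.le, hη1⟩
  have hG0 := hG.mono_set (uIcc_subset_uIcc_left hηmem)
  have hG1 := hG.mono_set (uIcc_subset_uIcc_right hηmem)
  have h2 : |∫ s in (0 : ℝ)..η, F (1 - s)| ≤ ∫ s in (0 : ℝ)..η, K * s ^ (β - 1) := by
    refine intervalIntegral.norm_integral_le_of_norm_le (f := fun s => F (1 - s)) hη.le
      (Eventually.of_forall fun s hs => hK s ⟨hs.1, hs.2.trans hη1⟩)
      ((intervalIntegral.intervalIntegrable_rpow' (r := β - 1) (by linarith)).const_mul K)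
  have h3 : |∫ s in η..1, F (1 - s)| ≤ ∫ s in η..1, L * s⁻¹ := by
    refine intervalIntegral.norm_integral_le_of_norm_le (f := fun s => F (1 - s)) hη1
      (Eventually.of_forall fun s hs => hL s ⟨hη.trans hs.1, hs.2⟩)
      ((intervalIntegral.intervalIntegrable_inv (f := fun s => s) (fun s hs => ?_) continuousOn_id).const_mul L)
    rw [uIcc_of_le hη1] at hs
    exact (hη.trans_le hs.1).ne'
  rw [intervalIntegral.integral_const_mul, integral_rpow (Or.inl (by linarith)), sub_add_cancel,
    Real.zero_rpow hβ.ne', sub_zero] at h2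
  rw [intervalIntegral.integral_const_mul, integral_inv_of_pos hη one_pos, one_div,
    Real.log_inv] at h3
  rw [h1, ← intervalIntegral.integral_add_adjacent_intervals hG0 hG1]
  refine (abs_add_le _ _).trans ?_
  linarith

lemma C1_nonneg {α : ℝ} (hα : 0 ≤ α) : 0 ≤ C1 α d := by
  have h1 : 0 ≤ Real.Gamma ((α + d) / 2) := Real.Gamma_nonneg_of_nonneg (by positivity)
  have h2 : 0 ≤ Real.Gamma ((d : ℝ) / 2) := Real.Gamma_nonneg_of_nonneg (by positivity)
  unfold C1
  positivity

variable {α C : ℝ} {g : EuclideanSpace ℝ (Fin d) → ℝ}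

lemma inner_sq_sub_one_eq_sum {u : EuclideanSpace ℝ (Fin d)} (hu : ‖u‖ = 1)
    (z : EuclideanSpace ℝ (Fin d)) :
    inner ℝ u z ^ 2 - 1 =
      ∑ i, ∑ j, u i * u j * (z i * z j - (1 : Matrix (Fin d) (Fin d) ℝ) i j) := by
  have h1 : (1 : ℝ) = ∑ i, ∑ j, u i * u j * (1 : Matrix (Fin d) (Fin d) ℝ) i j := by
    have h2 := EuclideanSpace.real_norm_sq_eq u
    rw [hu, one_pow] at h2
    simpa [Matrix.one_apply, sq] using h2
  simp_rw [mul_sub, Finset.sum_sub_distrib]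
  rw [← h1, PiLp.inner_apply, sq, Finset.sum_mul_sum]
  congr 1
  refine Finset.sum_congr rfl fun i _ => Finset.sum_congr rfl fun j _ => ?_
  simp only [RCLike.inner_apply, conj_trivial]
  ring

lemma HolderConst.mehler_inner_sq_sub_one (hα : 0 < α) (hα1 : α ≤ 1) (hC : 0 ≤ C)
    (hg : HolderConst α C g) {u : EuclideanSpace ℝ (Fin d)} (hu : ‖u‖ = 1) (t : ℝ)
    (x : EuclideanSpace ℝ (Fin d)) :
    mehler g (fun z => inner ℝ u z ^ 2 - 1) t x = ∑ i, ∑ j, u i * u j *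
      mehler g (fun z => z i * z j - (1 : Matrix (Fin d) (Fin d) ℝ) i j) t x := by
  have hint (i j : Fin d) : Integrable (fun z => g (√t • x + √(1 - t) • z) •
      (u i * u j * (z i * z j - (1 : Matrix (Fin d) (Fin d) ℝ) i j)))
      (ProbabilityTheory.stdGaussian (EuclideanSpace ℝ (Fin d))) := by
    obtain ⟨hqc, ⟨A, a, hb⟩, -⟩ := isCentredWeight_hermite i j
    simpa only [smul_eq_mul, mul_left_comm] using
      (hg.integrable_smul hα hα1 hC hqc hb √t √(1 - t) x).const_mul (u i * u j)
  simp_rw [mehler, inner_sq_sub_one_eq_sum hu, Finset.smul_sum]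
  rw [integral_finsetSum _ fun i _ => integrable_finsetSum _ fun j _ => hint i j]
  refine Finset.sum_congr rfl fun i _ => ?_
  rw [integral_finsetSum _ fun j _ => hint i j]
  refine Finset.sum_congr rfl fun j _ => ?_
  rw [← integral_const_mul]
  simp only [smul_eq_mul, mul_left_comm]

lemma integrableOn_one_div_two_mul_one_sub_mul_sqrt_rpow (hα : 0 < α) :
    IntegrableOn (fun t : ℝ => 1 / (2 * (1 - t)) * √(1 - t) ^ α) (Ioo 0 1) :=
  integrableOn_one_sub (integrableOn_one_div_two_mul_sqrt_rpow hα)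

/-- The Hessian of Barbour's solution as a quadratic form. -/
theorem HolderConst.sum_hessEntry_steinSol (hα : 0 < α) (hα1 : α ≤ 1) (hC : 0 ≤ C)
    (hg : HolderConst α C g) {u : EuclideanSpace ℝ (Fin d)} (hu : ‖u‖ = 1)
    (x : EuclideanSpace ℝ (Fin d)) :
    ∑ i, ∑ j, u i * u j * hessEntry (steinSol d g) x i j =
      -∫ t in Ioo 0 1, 1 / (2 * (1 - t)) *
        mehler (_root_.hbar d g) (fun z => inner ℝ u z ^ 2 - 1) t x := by
  have hb := hg.hbar
  have hint (i j : Fin d) : IntegrableOn (fun t : ℝ => u i * u j * (1 / (2 * (1 - t)) *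
      mehler (_root_.hbar d g)
        (fun z => z i * z j - (1 : Matrix (Fin d) (Fin d) ℝ) i j) t x)) (Ioo 0 1) :=
    (hb.integrableOn_smul_mehler hα hα1 hC (isCentredWeight_hermite i j) (by fun_prop)
      (integrableOn_one_div_two_mul_one_sub_mul_sqrt_rpow hα) x).const_mul _
  simp_rw [hg.hessEntry_steinSol hα hα1 hC, hb.mehler_inner_sq_sub_one hα hα1 hC hu,
    Finset.mul_sum, mul_neg, Finset.sum_neg_distrib]
  congr 1
  simp_rw [mul_left_comm (1 / (_ : ℝ))]
  rw [integral_finsetSum _ fun i _ => integrable_finsetSum _ fun j _ => hint i j]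
  refine Finset.sum_congr rfl fun i _ => ?_
  rw [integral_finsetSum _ fun j _ => hint i j]
  refine Finset.sum_congr rfl fun j _ => ?_
  rw [integral_const_mul]

lemma HolderConst.abs_mehler_sub_mehler_le (hα : 0 < α) (hα1 : α ≤ 1) (hC : 0 ≤ C)
    (hg : HolderConst α C g) {q : EuclideanSpace ℝ (Fin d) → ℝ} (hq : IsCentredWeight q)
    {t : ℝ} (ht : t ≤ 1) (x y : EuclideanSpace ℝ (Fin d)) :
    |mehler g q t x - mehler g q t y| ≤ C * dist x y ^ α *
      ∫ z, |q z| ∂(ProbabilityTheory.stdGaussian (EuclideanSpace ℝ (Fin d))) := by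
  obtain ⟨hqc, ⟨A, a, hb⟩, -⟩ := hq
  have hqi : Integrable q (ProbabilityTheory.stdGaussian (EuclideanSpace ℝ (Fin d))) :=
    integrable_stdGaussian_of_norm_le hqc.aestronglyMeasurable hb
  rw [mehler, mehler, ← integral_sub (hg.integrable_smul hα hα1 hC hqc hb _ _ _)
    (hg.integrable_smul hα hα1 hC hqc hb _ _ _), ← integral_const_mul, ← Real.norm_eq_abs]
  refine norm_integral_le_of_norm_le (hqi.abs.const_mul _) (Eventually.of_forall fun z => ?_)
  rw [← sub_smul, norm_smul, Real.norm_eq_abs, Real.norm_eq_abs]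
  refine mul_le_mul_of_nonneg_right ((hg _ _).trans ?_) (abs_nonneg _)
  refine mul_le_mul_of_nonneg_left (Real.rpow_le_rpow dist_nonneg ?_ hα.le) hC
  rw [dist_add_right, dist_smul₀, Real.norm_of_nonneg (Real.sqrt_nonneg t)]
  exact mul_le_of_le_one_left dist_nonneg (Real.sqrt_le_one.2 ht)

theorem HolderConst.abs_sum_hessEntry_sub_le (hd : 1 ≤ d) (hα : 0 < α) (hα1 : α ≤ 1)
    (hC : 0 ≤ C) (hg : HolderConst α C g) {u : EuclideanSpace ℝ (Fin d)} (hu : ‖u‖ = 1)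
    {x y : EuclideanSpace ℝ (Fin d)} (hxy : x ≠ y) :
    |∑ i, ∑ j, u i * u j * hessEntry (steinSol d g) x i j -
        ∑ i, ∑ j, u i * u j * hessEntry (steinSol d g) y i j| ≤
      dist x y ^ α * (C1 α d + |Real.log (dist x y)|) * C := by
  have hb := hg.hbar
  have hq := isCentredWeight_inner_sq_sub_one hu
  have hI (x : EuclideanSpace ℝ (Fin d)) : IntegrableOn (fun t => 1 / (2 * (1 - t)) *
      mehler (_root_.hbar d g) (fun z => inner ℝ u z ^ 2 - 1) t x) (Ioo 0 1) :=
    hb.integrableOn_smul_mehler hα hα1 hC hq (by fun_prop)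
      (integrableOn_one_div_two_mul_one_sub_mul_sqrt_rpow hα) x
  have hM := integral_rpow_norm_mul_abs_inner_sq_sub_one_le hd hα hα1 hu
  have hN := integral_abs_inner_sq_sub_one_stdGaussian_le hu
  have hC1 := C1_nonneg (d := d) hα.le
  have hδ : 0 < dist x y := dist_pos.2 hxy
  rw [hg.sum_hessEntry_steinSol hα hα1 hC hu, hg.sum_hessEntry_steinSol hα hα1 hC hu,
    neg_sub_neg, abs_sub_comm, ← integral_sub (hI x) (hI y)]
  simp_rw [← mul_sub]
  set w : EuclideanSpace ℝ (Fin d) → ℝ := fun z => inner ℝ u z ^ 2 - 1 with hw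
  set M := ∫ z, ‖z‖ ^ α * ‖inner ℝ u z ^ 2 - 1‖
    ∂(ProbabilityTheory.stdGaussian (EuclideanSpace ℝ (Fin d)))
  set δ := dist x y
  have hM0 : 0 ≤ M := integral_nonneg fun z => by positivity
  have hη : 0 < min 1 (δ ^ 2) := by positivity
  have key := abs_integral_Ioo_le_of_rpow_of_inv
    (F := fun t => 1 / (2 * (1 - t)) *
      (mehler (_root_.hbar d g) w t x - mehler (_root_.hbar d g) w t y))
    (β := α / 2) (K := C * M) (L := C * δ ^ α / 2)
    (((hI x).sub (hI y)).congr_fun (fun t _ => (mul_sub _ _ _).symm) measurableSet_Ioo) (half_pos hα) hη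
    (min_le_left _ _) (fun s hs => ?_) (fun s hs => ?_)
  · refine key.trans ?_
    have h1 : min 1 (δ ^ 2) ^ (α / 2) ≤ δ ^ α := by
      calc _ ≤ (δ ^ 2) ^ (α / 2) := Real.rpow_le_rpow hη.le (min_le_right _ _) (by positivity)
        _ = δ ^ α := by
          rw [← Real.rpow_two, ← Real.rpow_mul hδ.le]
          congr 1
          ring
    have h2 : -Real.log (min 1 (δ ^ 2)) ≤ 2 * |Real.log δ| := by
      rcases le_total 1 (δ ^ 2) with h | h
      · rw [min_eq_left h, Real.log_one, neg_zero]
        positivity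
      · rw [min_eq_right h, Real.log_pow]
        push_cast
        linarith [neg_abs_le (Real.log δ)]
    have hδα : 0 ≤ δ ^ α := by positivity
    calc C * M * (min 1 (δ ^ 2) ^ (α / 2) / (α / 2)) -
          C * δ ^ α / 2 * Real.log (min 1 (δ ^ 2))
        = C * (2 / α * M) * min 1 (δ ^ 2) ^ (α / 2) +
          C * δ ^ α / 2 * -Real.log (min 1 (δ ^ 2)) := by field_simp; ring
      _ ≤ C * C1 α d * δ ^ α + C * δ ^ α / 2 * (2 * |Real.log δ|) := by gcongr
      _ = _ := by ring
  · obtain ⟨hqc, ⟨A, a, hqb⟩, hq0⟩ := hq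
    have h1 (x) : |mehler (_root_.hbar d g) w (1 - s) x| ≤ C * √s ^ α * M := by
      rw [mehler, sub_sub_cancel]
      exact hb.norm_integral_smul_le hα hα1 hC hqc hqb hq0 _ (Real.sqrt_nonneg s) x
    have hs0 := hs.1
    rw [sub_sub_cancel, abs_mul, abs_of_pos (by positivity : 0 < 1 / (2 * s))]
    calc 1 / (2 * s) * |mehler (_root_.hbar d g) w (1 - s) x -
          mehler (_root_.hbar d g) w (1 - s) y|
        ≤ 1 / (2 * s) * (C * √s ^ α * M + C * √s ^ α * M) := by
          gcongr
          exact (abs_sub _ _).trans (add_le_add (h1 x) (h1 y))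
      _ = 2 * C * M * (1 / (2 * s) * √s ^ α) := by ring
      _ = C * M * s ^ (α / 2 - 1) := by rw [one_div_two_mul_sqrt_rpow hs0]; ring
  · have hs0 := hs.1
    rw [sub_sub_cancel, abs_mul, abs_of_pos (by positivity : 0 < 1 / (2 * s))]
    have h1 := hb.abs_mehler_sub_mehler_le hα hα1 hC hq (t := 1 - s) (by linarith) x y
    calc 1 / (2 * s) * |mehler (_root_.hbar d g) w (1 - s) x -
          mehler (_root_.hbar d g) w (1 - s) y|
        ≤ 1 / (2 * s) * (C * δ ^ α * 1) := by
          gcongr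
          exact h1.trans (mul_le_mul_of_nonneg_left hN (by positivity))
      _ = C * δ ^ α / 2 * s⁻¹ := by field_simp

lemma HolderConst.isSymm_hessMatrix_steinSol (hα : 0 < α) (hα1 : α ≤ 1) (hC : 0 ≤ C)
    (hg : HolderConst α C g) (x : EuclideanSpace ℝ (Fin d)) :
    (hessMatrix (steinSol d g) x).IsSymm := by
  ext i j
  simp only [hessMatrix, Matrix.transpose_apply, Matrix.of_apply,
    hg.hessEntry_steinSol hα hα1 hC, mul_comm, Matrix.one_apply, eq_comm]

end Assembly

/-- **Proposition 2.2, display (2.12)**: `(1 + log)` `α`-Hölder regularity of the Hessian of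
Barbour's solution, in operator norm. -/
theorem steinSol_hessian_one_add_log_holder
    {d : ℕ} (hd : 1 ≤ d) {α : ℝ} (hα : α ∈ Set.Ioc (0 : ℝ) 1)
    (h : EuclideanSpace ℝ (Fin d) → ℝ)
    {C : ℝ} (hC0 : 0 ≤ C) (hC : HolderConst α C h) :
    ∀ x y : EuclideanSpace ℝ (Fin d), x ≠ y →
      matOpNorm (hessMatrix (steinSol d h) x - hessMatrix (steinSol d h) y) ≤
        dist x y ^ α * (C1 α d + |Real.log (dist x y)|) * C := by
  intro x y hxy
  obtain ⟨hα0, hα1⟩ := hα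
  have hC1 := C1_nonneg (d := d) hα0.le
  refine matOpNorm_le_of_isSymm ((hC.isSymm_hessMatrix_steinSol hα0 hα1 hC0 x).sub
    (hC.isSymm_hessMatrix_steinSol hα0 hα1 hC0 y)) (by positivity) fun u hu => ?_
  refine le_of_eq_of_le ?_ (hC.abs_sum_hessEntry_sub_le hd hα0 hα1 hC0 hu hxy)
  simp_rw [← Finset.sum_sub_distrib, ← mul_sub]
  rfl
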